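/- Let Ω ⊂ ℝⁿ be bounded and open, and let 𝓑₀, 𝓑 ⊂ ℝⁿ be open and bounded with closure(𝓑₀) ⊂ 𝓑. Let ψ ∈ C_c^∞(ℝ^{2n}) satisfy ψ(x,ξ) = 1 for ξ ∈ 𝓑₀ and ψ(x,ξ) = 0 for ξ ∉ 𝓑, and let (f_h) ⊂ C_c^∞(Ω) satisfy ‖(Id − ψ(x,hD))f_h‖_{H_h^m} = O_m(h^∞)·‖f_h‖_{L²} for every m ≥ 0. Let χ̂ ∈ C_c^∞(ℝⁿ) satisfy supp χ̂ ⊂ 𝓑 and χ̂(ξ)ψ(x,ξ) = ψ(x,ξ) for all (x,ξ), and set χ := inverse Fourier transform of χ̂. Let W be an invertible real n×n matrix and 0 < s < 1 be such that the translates 𝓑 + (2π/s)(Wᵀ)^{−1}k, k ∈ ℤⁿ, are mutually disjoint. Then f_h(x) = |det W|·sⁿ·Σ_{k∈ℤⁿ} f_h(shWk) χ((x − shWk)/h) + r_h(x) with ‖r_h‖_{L²} = O(h^∞)‖f_h‖_{L²}, and ‖f_h‖²_{L²} = |det W|(sh)ⁿ Σ_{k∈ℤⁿ} |f_h(shWk)|²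 + O(h^∞)‖f_h‖²_{L²}. -/

import Mathlib

open MeasureTheory Complex

/-- The Euclidean pairing `x·ξ = ∑ xʲξⱼ` on `ℝⁿ`. -/
noncomputable def dotp {n : ℕ} (x ξ : Fin n → ℝ) : ℝ := ∑ j, x j * ξ j

/-- The semiclassical Fourier transform `F_h g(ξ) = ∫ e^{−i x·ξ/h} g(x) dx`. -/
noncomputable def scFT {n : ℕ} (h : ℝ) (g : (Fin n → ℝ) → ℂ) (ξ : Fin n → ℝ) : ℂ :=
  ∫ x : Fin n → ℝ, Complex.exp (((-(dotp x ξ) / h : ℝ) : ℂ) * Complex.I) * g x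

/-- The squared semiclassical Sobolev norm
`‖f‖²_{H_h^m} = (2πh)^{−n} ∫ (1+|ξ|²)^m |F_h f(ξ)|² dξ`. -/
noncomputable def hSobSq (n : ℕ) (h m : ℝ) (f : (Fin n → ℝ) → ℂ) : ℝ :=
  (2 * Real.pi * h) ^ (-(n : ℤ)) *
    ∫ ξ : Fin n → ℝ, (1 + ∑ j, ξ j ^ 2) ^ m * ‖scFT h f ξ‖ ^ 2

/-- The semiclassical quantization
`ψ(x,hD)f(x) = (2πh)^{−n} ∬ e^{i(x−y)·ξ/h} ψ(x,ξ) f(y) dy dξ` (the `y`-integral first). -/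
noncomputable def scOp {n : ℕ} (h : ℝ) (ψ : (Fin n → ℝ) → (Fin n → ℝ) → ℂ)
    (f : (Fin n → ℝ) → ℂ) (x : Fin n → ℝ) : ℂ :=
  ((2 * Real.pi * h) ^ (-(n : ℤ)) : ℝ) •
    ∫ ξ : Fin n → ℝ, ∫ y : Fin n → ℝ,
      Complex.exp (((dotp (x - y) ξ / h : ℝ) : ℂ) * Complex.I) * ψ x ξ * f y

/-- The inverse Fourier transform `χ = F⁻¹[χ̂]`, `χ(x) = (2π)^{−n} ∫ e^{i x·ξ} χ̂(ξ) dξ`. -/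
noncomputable def invFTn {n : ℕ} (g : (Fin n → ℝ) → ℂ) (x : Fin n → ℝ) : ℂ :=
  ((2 * Real.pi) ^ n)⁻¹ • ∫ ξ : Fin n → ℝ, Complex.exp ((dotp x ξ : ℂ) * Complex.I) * g ξ

theorem dotp_continuous {n : ℕ} : Continuous fun p : (Fin n → ℝ) × (Fin n → ℝ) => dotp p.1 p.2 := by
  unfold dotp; fun_prop

@[fun_prop]
theorem Continuous.dotp {X : Type*} [TopologicalSpace X] {n : ℕ} {a b : X → Fin n → ℝ}
    (ha : Continuous a) (hb : Continuous b) : Continuous fun x => dotp (a x) (b x) :=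
  dotp_continuous.comp (ha.prodMk hb)

theorem dotp_smul_right {n : ℕ} (c : ℝ) (x ξ : Fin n → ℝ) : dotp x (c • ξ) = c * dotp x ξ := by
  simp only [dotp, Finset.mul_sum, Pi.smul_apply, smul_eq_mul]
  exact Finset.sum_congr rfl fun _ _ => by ring

theorem dotp_smul_left {n : ℕ} (c : ℝ) (x ξ : Fin n → ℝ) : dotp (c • x) ξ = c * dotp x ξ := by
  simp only [dotp, Finset.mul_sum, Pi.smul_apply, smul_eq_mul]
  exact Finset.sum_congr rfl fun _ _ => by ring

theorem dotp_add_right {n : ℕ} (x ξ η : Fin n → ℝ) : dotp x (ξ + η) = dotp x ξ + dotp x η := by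
  simp [dotp, mul_add, Finset.sum_add_distrib]

theorem dotp_sub_right {n : ℕ} (x ξ η : Fin n → ℝ) : dotp x (ξ - η) = dotp x ξ - dotp x η := by
  simp [dotp, mul_sub, Finset.sum_sub_distrib]

theorem dotp_sub_left {n : ℕ} (x y ξ : Fin n → ℝ) : dotp (x - y) ξ = dotp x ξ - dotp y ξ := by
  simp [dotp, sub_mul, Finset.sum_sub_distrib]

theorem norm_exp_ofReal_mul_I_mul (t : ℝ) (z : ℂ) : ‖exp ((t : ℂ) * I) * z‖ = ‖z‖ := by
  rw [norm_mul, norm_exp_ofReal_mul_I, one_mul]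

theorem scFT_eq_scFT_one {n : ℕ} (h : ℝ) (g : (Fin n → ℝ) → ℂ) (ξ : Fin n → ℝ) :
    scFT h g ξ = scFT 1 g (h⁻¹ • ξ) := by
  simp only [scFT, dotp_smul_right, div_one]
  congr! 6
  ring

theorem norm_scFT_le {n : ℕ} (h : ℝ) (g : (Fin n → ℝ) → ℂ) (ξ : Fin n → ℝ) :
    ‖scFT h g ξ‖ ≤ ∫ x, ‖g x‖ := by
  refine (norm_integral_le_integral_norm _).trans_eq ?_
  simp only [norm_exp_ofReal_mul_I_mul]

/-- Integration by parts: multiplication by `θ j` corresponds to differentiation along `x j`. -/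
theorem norm_mul_scFT_one_eq {n : ℕ} {g : (Fin n → ℝ) → ℂ} (hg : ContDiff ℝ 1 g)
    (hgc : HasCompactSupport g) (j : Fin n) (θ : Fin n → ℝ) :
    |θ j| * ‖scFT 1 g θ‖ = ‖scFT 1 (fun x => fderiv ℝ g x (Pi.single j 1)) θ‖ := by
  set e : (Fin n → ℝ) → ℂ := fun x => exp (((-(dotp x θ) / 1 : ℝ) : ℂ) * I) with he
  have hd : ∀ x, HasFDerivAt e
      (e x • (-(∑ i, θ i • (ContinuousLinearMap.proj (R := ℝ) (φ := fun _ : Fin n => ℝ) i))).smulRight I) x := by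
    intro x
    have h1 : HasFDerivAt (fun x : Fin n → ℝ => -(dotp x θ) / 1)
        (-(∑ i, θ i • (ContinuousLinearMap.proj (R := ℝ) (φ := fun _ : Fin n => ℝ) i))) x := by
      simp only [div_one, dotp]
      refine HasFDerivAt.neg ?_
      refine HasFDerivAt.fun_sum fun i _ => ?_
      exact (hasFDerivAt_apply i x).mul_const (θ i)
    have h2 : HasFDerivAt (fun x : Fin n → ℝ => ((-(dotp x θ) / 1 : ℝ) : ℂ) * I)
        ((-(∑ i, θ i • (ContinuousLinearMap.proj (R := ℝ) (φ := fun _ : Fin n => ℝ) i))).smulRight I) x := by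
      have h3 := h1.smul_const I
      simpa only [real_smul] using h3
    exact h2.cexp
  have hec : Continuous e := by rw [he]; fun_prop
  have hfe : ∀ x, fderiv ℝ e x (Pi.single j 1) = -(θ j * I) * e x := by
    intro x
    rw [(hd x).fderiv]
    simp [Pi.single_apply]
    ring
  have hgd : Continuous fun x => fderiv ℝ g x (Pi.single j 1) :=
    (hg.continuous_fderiv one_ne_zero).clm_apply continuous_const
  have key := integral_mul_fderiv_eq_neg_fderiv_mul_of_integrable (μ := (volume : Measure (Fin n → ℝ)))
    (f := e) (g := g) (v := Pi.single j 1) ?_ ?_ ?_ (fun x _ => (hd x).differentiableAt)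
    (fun x _ => hg.differentiable one_ne_zero x)
  · simp only [hfe, mul_assoc, integral_const_mul, integral_neg, neg_mul, neg_neg] at key
    rw [scFT, scFT, key, norm_mul, norm_mul]
    simp [Complex.norm_real, he]
  · simp only [hfe]
    exact Continuous.integrable_of_hasCompactSupport (by have := hg.continuous; fun_prop)
      hgc.mul_left
  · exact Continuous.integrable_of_hasCompactSupport (by fun_prop)
      (HasCompactSupport.mul_left (hgc.fderiv_apply ℝ _))
  · exact Continuous.integrable_of_hasCompactSupport (by have := hg.continuous; fun_prop)
      hgc.mul_left

theorem exists_forall_integral_norm_slice_le {n : ℕ} {E' : Type*} [NormedAddCommGroup E']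
    {φ : (Fin n → ℝ) × E' → ℂ} (hφ : Continuous φ) (hφc : HasCompactSupport φ) :
    ∃ C : ℝ, 0 ≤ C ∧ ∀ y, ∫ x, ‖φ (x, y)‖ ≤ C := by
  obtain ⟨B, hB⟩ := hφc.exists_bound_of_continuous hφ
  set K := Prod.fst '' tsupport φ
  have hK : IsCompact K := hφc.isCompact.image continuous_fst
  have hB0 : 0 ≤ B := (norm_nonneg _).trans (hB (0, 0))
  refine ⟨B * volume.real K, by positivity, fun y => ?_⟩
  rw [← setIntegral_eq_integral_of_forall_compl_eq_zero (s := K)]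
  · refine (le_abs_self _).trans ?_
    rw [← Real.norm_eq_abs]
    refine norm_setIntegral_le_of_norm_le_const hK.measure_lt_top fun x _ => ?_
    simpa using hB (x, y)
  · intro x hx
    rw [norm_eq_zero]
    exact image_eq_zero_of_notMem_tsupport fun h => hx ⟨_, h, rfl⟩

theorem hasCompactSupport_slice {n : ℕ} {E' : Type*} [NormedAddCommGroup E']
    {φ : (Fin n → ℝ) × E' → ℂ} (hφc : HasCompactSupport φ) (y : E') :
    HasCompactSupport fun x => φ (x, y) :=
  HasCompactSupport.intro (hφc.isCompact.image continuous_fst) fun _ hx =>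
    image_eq_zero_of_notMem_tsupport fun h => hx ⟨_, h, rfl⟩

theorem exists_forall_abs_pow_mul_norm_scFT_slice_le {n : ℕ} {E' : Type*} [NormedAddCommGroup E']
    [NormedSpace ℝ E'] (j : Fin n) (N : ℕ) :
    ∀ {φ : (Fin n → ℝ) × E' → ℂ}, ContDiff ℝ (⊤ : ℕ∞) φ → HasCompactSupport φ →
    ∃ C : ℝ, 0 ≤ C ∧ ∀ θ y, |θ j| ^ N * ‖scFT 1 (fun x => φ (x, y)) θ‖ ≤ C := by
  induction N with
  | zero =>
    intro φ hφ hφc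
    obtain ⟨C, hC0, hC⟩ := exists_forall_integral_norm_slice_le hφ.continuous hφc
    exact ⟨C, hC0, fun θ y => by simpa using (norm_scFT_le 1 _ θ).trans (hC y)⟩
  | succ N ih =>
    intro φ hφ hφc
    obtain ⟨C, hC0, hC⟩ := ih (φ := fun p => fderiv ℝ φ p (Pi.single j 1, 0))
      ((hφ.fderiv_right (m := (⊤ : ℕ∞)) le_rfl).clm_apply contDiff_const) (hφc.fderiv_apply ℝ _)
    refine ⟨C, hC0, fun θ y => ?_⟩
    have hs : ContDiff ℝ (⊤ : ℕ∞) fun x : Fin n → ℝ => φ (x, y) := hφ.comp (contDiff_prodMk_left y)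
    rw [pow_succ, mul_assoc, norm_mul_scFT_one_eq (hs.of_le (mod_cast le_top))
      (hasCompactSupport_slice hφc y)]
    refine le_trans (le_of_eq ?_) (hC θ y)
    congr! 4 with x
    have h1 : HasFDerivAt (fun x : Fin n → ℝ => (x, y)) (ContinuousLinearMap.inl ℝ (Fin n → ℝ) E') x :=
      hasFDerivAt_prodMk_left x y
    have h2 := ((hφ.differentiable (by simp)) (x, y)).hasFDerivAt.comp x h1
    have h3 := h2.fderiv
    simp only [Function.comp_def] at h3
    rw [h3]
    simp

/-- Rapid decay of the partial Fourier transform of a smooth compactly supported function,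
uniformly in the parameter. -/
theorem exists_forall_one_add_norm_pow_mul_scFT_slice_le {n : ℕ} {E' : Type*}
    [NormedAddCommGroup E'] [NormedSpace ℝ E'] (N : ℕ) {φ : (Fin n → ℝ) × E' → ℂ}
    (hφ : ContDiff ℝ (⊤ : ℕ∞) φ) (hφc : HasCompactSupport φ) :
    ∃ C : ℝ, 0 ≤ C ∧ ∀ θ y, (1 + ‖θ‖) ^ N * ‖scFT 1 (fun x => φ (x, y)) θ‖ ≤ C := by
  obtain ⟨C0, hC00, hC0⟩ := exists_forall_integral_norm_slice_le hφ.continuous hφc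
  choose C hC' hC using fun j => exists_forall_abs_pow_mul_norm_scFT_slice_le j N hφ hφc
  refine ⟨2 ^ N * (2 * C0 + ∑ j, C j), by have := Finset.sum_nonneg fun j (_ : j ∈ Finset.univ) => hC' j; positivity, fun θ y => ?_⟩
  set Z := ‖scFT 1 (fun x => φ (x, y)) θ‖
  have hZ : Z ≤ C0 := (norm_scFT_le 1 _ θ).trans (hC0 y)
  have hZ0 : 0 ≤ Z := norm_nonneg _
  have h1 : (1 + ‖θ‖) ^ N ≤ 2 ^ N * (1 + ‖θ‖ ^ N) := by
    refine (add_pow_le zero_le_one (norm_nonneg _) N).trans ?_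
    rw [one_pow]
    gcongr
    · norm_num
    · omega
  have h2 : ‖θ‖ ^ N ≤ 1 + ∑ j, |θ j| ^ N := by
    have hs : 0 ≤ ∑ j, |θ j| ^ N := by positivity
    rcases isEmpty_or_nonempty (Fin n) with he | he
    · have : ‖θ‖ = 0 := by simp [Subsingleton.elim θ 0]
      rw [this]
      have := pow_le_one₀ (n := N) le_rfl (zero_le_one (α := ℝ))
      linarith
    · obtain ⟨j, -, hj⟩ := Finset.exists_mem_eq_sup' Finset.univ_nonempty fun j => ‖θ j‖₊
      have : ‖θ‖ = |θ j| := by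
        rw [Pi.norm_def, ← Finset.sup'_eq_sup Finset.univ_nonempty, hj]; rfl
      rw [this]
      have := Finset.single_le_sum (f := fun j => |θ j| ^ N) (fun i _ => by positivity) (Finset.mem_univ j)
      linarith
  calc (1 + ‖θ‖) ^ N * Z ≤ (2 ^ N * (1 + (1 + ∑ j, |θ j| ^ N))) * Z := by gcongr; exact h1.trans (by gcongr)
    _ = 2 ^ N * (2 * Z + ∑ j, |θ j| ^ N * Z) := by rw [← Finset.sum_mul]; ring
    _ ≤ _ := by gcongr with j; exact hC j θ y

theorem exists_forall_norm_le_norm_sub_pow {E : Type} [NormedAddCommGroup E] [NormedSpace ℝ E]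
    {K : Set E} (hK : IsOpen K) (M : ℕ) :
    ∀ {F : Type} [NormedAddCommGroup F] [NormedSpace ℝ F] {g : E → F}, ContDiff ℝ (⊤ : ℕ∞) g →
    HasCompactSupport (fderiv ℝ g) → (∃ B, ∀ x, ‖g x‖ ≤ B) → (∀ x ∈ K, g x = 0) →
    ∃ C : ℝ, 0 ≤ C ∧ ∀ ξ ∈ K, ∀ η, ‖g η‖ ≤ C * ‖η - ξ‖ ^ M := by
  induction M with
  | zero =>
    rintro F _ _ g hg hgc ⟨B, hB⟩ h0
    exact ⟨B, (norm_nonneg _).trans (hB 0), fun ξ _ η => by simpa using hB η⟩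
  | succ M ih =>
    rintro F _ _ g hg hgc - h0
    have hg' : ContDiff ℝ (⊤ : ℕ∞) (fderiv ℝ g) := hg.fderiv_right le_rfl
    obtain ⟨C, hC0, hC⟩ := ih hg' (hgc.fderiv ℝ)
      (hgc.exists_bound_of_continuous hg'.continuous) (by
        intro x hx
        have : g =ᶠ[nhds x] fun _ => 0 := by
          filter_upwards [hK.mem_nhds hx] with y hy using h0 y hy
        rw [this.fderiv_eq]; simp)
    refine ⟨C, hC0, fun ξ hξ η => ?_⟩
    have := (convex_closedBall ξ ‖η - ξ‖).norm_image_sub_le_of_norm_fderiv_le (𝕜 := ℝ) (f := g)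
      (C := C * ‖η - ξ‖ ^ M) (x := ξ) (y := η) (fun x _ => hg.differentiable (by simp) x)
      (fun x hx => (hC ξ hξ x).trans (by
        gcongr; simpa [dist_eq_norm] using hx)) (by simp) (by simp [dist_eq_norm])
    rw [h0 ξ hξ, sub_zero] at this
    rw [pow_succ, ← mul_assoc]
    exact this

theorem finite_setOf_norm_intCast_le {n : ℕ} (R : ℝ) :
    {k : Fin n → ℤ | ‖fun i => (k i : ℝ)‖ ≤ R}.Finite := by
  refine (Set.finite_Icc (fun _ => -⌈R⌉ : Fin n → ℤ) (fun _ => ⌈R⌉)).subset fun k hk => ?_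
  have h : ∀ i, |(k i : ℝ)| ≤ R := fun i => (norm_le_pi_norm (fun i => (k i : ℝ)) i).trans hk
  constructor <;> intro i
  · have := (abs_le.1 (h i)).1
    have h2 := Int.le_ceil R
    have : (-⌈R⌉ : ℝ) ≤ k i := by linarith
    exact_mod_cast this
  · have := (abs_le.1 (h i)).2
    exact_mod_cast this.trans (Int.le_ceil R)

theorem isOpenQuotientMap_coe_unitAddTorus (n : ℕ) :
    IsOpenQuotientMap (fun (x : Fin n → ℝ) (i : Fin n) => (x i : UnitAddCircle)) :=
  IsOpenQuotientMap.piMap fun _ => QuotientAddGroup.isOpenQuotientMap_mk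

theorem exists_add_intCast_of_coe_eq {n : ℕ} {x y : Fin n → ℝ}
    (h : (fun i => (x i : UnitAddCircle)) = fun i => (y i : UnitAddCircle)) :
    ∃ k : Fin n → ℤ, y = x + fun i => (k i : ℝ) := by
  have : ∀ i, ∃ k : ℤ, y i = x i + k := by
    intro i
    obtain ⟨k, hk⟩ := AddSubgroup.mem_zmultiples_iff.1 (QuotientAddGroup.eq.1 (congrFun h i))
    refine ⟨k, ?_⟩
    simp only [zsmul_eq_mul, mul_one] at hk
    rw [hk]; ring
  choose k hk using this
  exact ⟨k, funext hk⟩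

theorem mFourier_coe {n : ℕ} (m : Fin n → ℤ) (x : Fin n → ℝ) :
    UnitAddTorus.mFourier m (fun i => (x i : UnitAddCircle)) =
      exp (((2 * Real.pi * dotp x (fun i => (m i : ℝ)) : ℝ) : ℂ) * I) := by
  simp only [UnitAddTorus.mFourier, ContinuousMap.coe_mk, fourier_coe_apply, ← Complex.exp_sum, dotp]
  congr 1
  push_cast
  rw [Finset.mul_sum, Finset.sum_mul]
  refine Finset.sum_congr rfl fun i _ => by simp; ring

theorem hasSum_setIntegral_unitBox {n : ℕ} {E : Type*} [NormedAddCommGroup E] [NormedSpace ℝ E]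
    {F : (Fin n → ℝ) → E} (hF : Integrable F) :
    HasSum (fun k : Fin n → ℤ =>
      ∫ x in {x : Fin n → ℝ | ∀ i, x i ∈ Set.Ioc (0 : ℝ) (0 + 1)}, F (x + fun i => (k i : ℝ)))
      (∫ x, F x) := by
  set B : (Fin n → ℤ) → Set (Fin n → ℝ) :=
    fun k => {x | ∀ i, x i ∈ Set.Ioc (k i : ℝ) (k i + 1)} with hB
  have hBm : ∀ k, MeasurableSet (B k) := fun k =>
    MeasurableSet.univ_pi' fun i => measurableSet_Ioc
  have hBd : Pairwise (Function.onFun Disjoint B) := by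
    intro k l hkl
    refine Set.disjoint_left.2 fun x hk hl => hkl (funext fun i => ?_)
    have h1 : ⌈x i⌉ = k i + 1 := Int.ceil_eq_iff.2 (by have := hk i; push_cast; simpa using this)
    have h2 : ⌈x i⌉ = l i + 1 := Int.ceil_eq_iff.2 (by have := hl i; push_cast; simpa using this)
    omega
  have hBu : ⋃ k, B k = Set.univ := by
    refine Set.eq_univ_of_forall fun x => Set.mem_iUnion.2 ⟨fun i => ⌈x i⌉ - 1, fun i => ?_⟩
    have := Int.ceil_eq_iff.1 (rfl : ⌈x i⌉ = ⌈x i⌉)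
    push_cast
    simpa using this
  have hsum := hasSum_integral_iUnion hBm hBd (f := F) hF.integrableOn
  rw [hBu, setIntegral_univ] at hsum
  convert hsum using 2 with k
  have := (measurePreserving_add_right (volume : Measure (Fin n → ℝ)) (fun i => (k i : ℝ))).setIntegral_preimage_emb
    (measurableEmbedding_addRight _) F (B k)
  rw [← this]
  congr 2
  ext x
  refine forall_congr' fun i => ?_
  simp only [Pi.add_apply, Set.mem_Ioc, zero_add]
  constructor <;> rintro ⟨h1, h2⟩ <;> constructor <;> linarith

/-- The multidimensional Poisson summation formula. -/
theorem tsum_intCast_eq_tsum_scFT {n : ℕ} {φ : (Fin n → ℝ) → ℂ} (hφ : Continuous φ)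
    (hφc : HasCompactSupport φ)
    (hs : Summable fun m : Fin n → ℤ => scFT 1 φ ((2 * Real.pi) • fun i => (m i : ℝ))) :
    ∑' k : Fin n → ℤ, φ (fun i => (k i : ℝ)) =
      ∑' m : Fin n → ℤ, scFT 1 φ ((2 * Real.pi) • fun i => (m i : ℝ)) := by
  obtain ⟨R, hR⟩ := hφc.isCompact.isBounded.exists_norm_le
  have hzero : ∀ x, R < ‖x‖ → φ x = 0 := fun x hx =>
    image_eq_zero_of_notMem_tsupport fun h => hx.not_ge (hR x h)
  have hfin : ∀ S : ℝ, {k : Fin n → ℤ | ∃ x : Fin n → ℝ, ‖x‖ ≤ S ∧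
      φ (x + fun i => (k i : ℝ)) ≠ 0}.Finite := by
    intro S
    refine (finite_setOf_norm_intCast_le (R + S)).subset ?_
    rintro k ⟨x, hx, hk⟩
    have h1 := not_lt.1 fun h => hk (hzero _ h)
    have h2 := norm_sub_le (x + fun i => (k i : ℝ)) x
    rw [add_sub_cancel_left] at h2
    exact h2.trans (by linarith)
  set Φ : (Fin n → ℝ) → ℂ := fun x => ∑ᶠ k : Fin n → ℤ, φ (x + fun i => (k i : ℝ)) with hΦ
  have hΦc : Continuous Φ := by
    refine continuous_finsum (fun k => by fun_prop) fun x => ?_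
    refine ⟨Metric.ball x 1, Metric.ball_mem_nhds _ one_pos, (hfin (‖x‖ + 1)).subset ?_⟩
    rintro k ⟨y, hy1, hy2⟩
    refine ⟨y, ?_, hy1⟩
    have h1 := norm_le_norm_add_norm_sub' y x
    rw [Metric.mem_ball, dist_eq_norm] at hy2
    linarith
  have hΦp : ∀ x (k : Fin n → ℤ), Φ (x + fun i => (k i : ℝ)) = Φ x := by
    intro x k
    simp only [hΦ]
    rw [← finsum_comp_equiv (Equiv.addLeft k) (f := fun l : Fin n → ℤ => φ (x + fun i => (l i : ℝ)))]
    refine finsum_congr fun l => ?_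
    congr 1
    ext i
    simp [add_assoc]
  set π : (Fin n → ℝ) → UnitAddTorus (Fin n) := fun x i => (x i : UnitAddCircle) with hπ
  have hq : IsOpenQuotientMap π := isOpenQuotientMap_coe_unitAddTorus n
  set Ψ : UnitAddTorus (Fin n) → ℂ := fun t => Φ (Function.surjInv hq.surjective t) with hΨ
  have hΨπ : ∀ x, Ψ (π x) = Φ x := by
    intro x
    obtain ⟨k, hk⟩ := exists_add_intCast_of_coe_eq (Function.surjInv_eq hq.surjective (π x))
    simp only [hΨ]
    rw [← hΦp (Function.surjInv hq.surjective (π x)) k, ← hk]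
  have hΨc : Continuous Ψ := by
    rw [← hq.continuous_comp_iff]
    exact hΦc.congr fun x => (hΨπ x).symm
  have hcoeff : ∀ m, UnitAddTorus.mFourierCoeff Ψ m = scFT 1 φ ((2 * Real.pi) • fun i => (m i : ℝ)) := by
    intro m
    rw [UnitAddTorus.mFourierCoeff_eq_integral Ψ m (fun _ => 0)]
    set F : (Fin n → ℝ) → ℂ := fun x => UnitAddTorus.mFourier (-m) (π x) * φ x with hF
    have hFc : Continuous F := by
      have := (UnitAddTorus.mFourier (-m)).continuous.comp hq.continuous
      exact this.mul hφ
    have hFi : Integrable F := hFc.integrable_of_hasCompactSupport hφc.mul_left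
    have hFeq : ∫ x, F x = scFT 1 φ ((2 * Real.pi) • fun i => (m i : ℝ)) := by
      simp only [hF, hπ, mFourier_coe, scFT, dotp_smul_right, div_one]
      congr! 6
      simp [dotp]
    rw [← hFeq, ← (hasSum_setIntegral_unitBox hFi).tsum_eq]
    set B : Set (Fin n → ℝ) := {x | ∀ i, x i ∈ Set.Ioc (0 : ℝ) (0 + 1)} with hB
    have hBm : MeasurableSet B := MeasurableSet.univ_pi' fun i => measurableSet_Ioc
    have hBn : ∀ x ∈ B, ‖x‖ ≤ 1 := fun x hx => (pi_norm_le_iff_of_nonneg zero_le_one).2 fun i => by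
      have := hx i
      rw [Real.norm_eq_abs, abs_le]; constructor <;> linarith [this.1, this.2]
    have hper : ∀ x (k : Fin n → ℤ), π (x + fun i => (k i : ℝ)) = π x := by
      intro x k
      ext i
      simp only [hπ, Pi.add_apply]
      refine (QuotientAddGroup.eq.2 (AddSubgroup.mem_zmultiples_iff.2 ⟨-k i, ?_⟩))
      simp
    rw [tsum_eq_sum (s := (hfin 1).toFinset), ← integral_finsetSum]
    · refine setIntegral_congr_fun hBm fun x hx => ?_
      change UnitAddTorus.mFourier (-m) (π x) * Ψ (π x) = _
      rw [hΨπ]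
      simp only [hF, hper, hΦ, ← Finset.mul_sum]
      congr 1
      refine finsum_eq_sum_of_support_subset _ fun k hk => ?_
      simpa using ⟨x, hBn x hx, hk⟩
    · intro k _
      exact (hFi.comp_add_right _).integrableOn
    · intro k hk
      refine setIntegral_eq_zero_of_forall_eq_zero fun x hx => ?_
      have : φ (x + fun i => (k i : ℝ)) = 0 := by
        by_contra h
        exact hk (by simpa using ⟨x, hBn x hx, h⟩)
      simp [hF, this]
  have hsum := UnitAddTorus.hasSum_mFourier_series_apply_of_summable (f := ⟨Ψ, hΨc⟩)
    (by simpa only [ContinuousMap.coe_mk, funext hcoeff] using hs) (π 0)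
  simp only [ContinuousMap.coe_mk, hcoeff, hΨπ] at hsum
  have h1 : ∀ m, UnitAddTorus.mFourier m (π 0) = 1 := fun m => by
    rw [mFourier_coe]; simp [dotp]
  simp only [h1, smul_eq_mul, mul_one] at hsum
  rw [hsum.tsum_eq]
  simp only [hΦ, zero_add]
  refine tsum_eq_finsum ((hfin 0).subset fun k hk => ⟨0, by simp, by simpa using hk⟩)

theorem exists_forall_one_add_norm_pow_mul_scFT_le {n : ℕ} (N : ℕ) {φ : (Fin n → ℝ) → ℂ}
    (hφ : ContDiff ℝ (⊤ : ℕ∞) φ) (hφc : HasCompactSupport φ) :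
    ∃ C : ℝ, 0 ≤ C ∧ ∀ θ, (1 + ‖θ‖) ^ N * ‖scFT 1 φ θ‖ ≤ C := by
  obtain ⟨C, hC0, hC⟩ := exists_forall_one_add_norm_pow_mul_scFT_slice_le N
    (φ := fun p : (Fin n → ℝ) × (Fin 0 → ℝ) => φ p.1) (hφ.comp contDiff_fst)
    (HasCompactSupport.intro (hφc.isCompact.prod isCompact_univ) fun p hp =>
      image_eq_zero_of_notMem_tsupport fun h => hp ⟨h, trivial⟩)
  exact ⟨C, hC0, fun θ => hC θ 0⟩

theorem summable_one_add_norm_intCast_pow_inv (n : ℕ) :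
    Summable fun m : Fin n → ℤ => ((1 + ‖fun i => (m i : ℝ)‖) ^ (n + 1))⁻¹ := by
  set B : Set (Fin n → ℝ) := {x | ∀ i, x i ∈ Set.Ioc (0 : ℝ) (0 + 1)} with hB
  have hBm : MeasurableSet B := MeasurableSet.univ_pi' fun i => measurableSet_Ioc
  have hBv : volume.real B = 1 := by
    have : B = Set.univ.pi fun _ => Set.Ioc (0 : ℝ) (0 + 1) := by ext; simp [hB]
    rw [this, Measure.real, Real.volume_pi_Ioc]
    simp
  have hBn : ∀ x ∈ B, ‖x‖ ≤ 1 := fun x hx => (pi_norm_le_iff_of_nonneg zero_le_one).2 fun i => by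
    have := hx i
    rw [Real.norm_eq_abs, abs_le]; constructor <;> linarith [this.1, this.2]
  have hF : Integrable fun x : Fin n → ℝ => ((1 + ‖x‖) ^ (n + 1))⁻¹ := by
    have := integrable_one_add_norm (μ := (volume : Measure (Fin n → ℝ))) (r := (n + 1 : ℕ)) (by simp)
    refine this.congr (Filter.Eventually.of_forall fun x => ?_)
    simp only
    rw [Real.rpow_neg (by positivity), Real.rpow_natCast]
  refine Summable.of_nonneg_of_le (fun m => by positivity) (fun m => ?_)
    ((hasSum_setIntegral_unitBox hF).summable.mul_left (2 ^ (n + 1)))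
  have hl : ∫ x in B, ((2 * (1 + ‖fun i => (m i : ℝ)‖)) ^ (n + 1))⁻¹ ≤
      ∫ x in B, ((1 + ‖x + fun i => (m i : ℝ)‖) ^ (n + 1))⁻¹ := by
    refine setIntegral_mono_on (integrableOn_const (by
      intro h; rw [Measure.real, h] at hBv; simp at hBv)) (hF.comp_add_right _).integrableOn hBm
      fun x hx => ?_
    gcongr
    have := norm_add_le x fun i => (m i : ℝ)
    have := hBn x hx
    have := norm_nonneg fun i => (m i : ℝ)
    linarith
  rw [setIntegral_const, hBv, one_smul, mul_pow, mul_inv] at hl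
  calc _ = 2 ^ (n + 1) * ((2 ^ (n + 1))⁻¹ * ((1 + ‖fun i => (m i : ℝ)‖) ^ (n + 1))⁻¹) := by
        field_simp
    _ ≤ _ := by gcongr

theorem summable_scFT_two_pi_intCast {n : ℕ} {φ : (Fin n → ℝ) → ℂ} (hφ : ContDiff ℝ (⊤ : ℕ∞) φ)
    (hφc : HasCompactSupport φ) :
    Summable fun m : Fin n → ℤ => scFT 1 φ ((2 * Real.pi) • fun i => (m i : ℝ)) := by
  obtain ⟨C, hC0, hC⟩ := exists_forall_one_add_norm_pow_mul_scFT_le (n + 1) hφ hφc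
  refine Summable.of_norm_bounded ((summable_one_add_norm_intCast_pow_inv n).mul_left C) fun m => ?_
  rw [← div_eq_mul_inv, le_div_iff₀ (by positivity), mul_comm]
  refine le_trans ?_ (hC ((2 * Real.pi) • fun i => (m i : ℝ)))
  gcongr
  rw [norm_smul, Real.norm_of_nonneg (by positivity)]
  exact le_mul_of_one_le_left (norm_nonneg _) (by linarith [Real.pi_gt_three])

theorem abs_det_mul_integral_mulVec {n : ℕ} {A : Matrix (Fin n) (Fin n) ℝ} (hA : A.det ≠ 0)
    {F : (Fin n → ℝ) → ℂ} (hF : Continuous F) :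
    ((|A.det| : ℝ) : ℂ) * ∫ y, F (A.mulVec y) = ∫ x, F x := by
  have h1 := Real.map_matrix_volume_pi_eq_smul_volume_pi hA
  have h2 : ∫ y, F (A.mulVec y) = ∫ x, F x ∂(Measure.map (Matrix.toLin' A) volume) := by
    rw [integral_map (LinearMap.continuous_of_finiteDimensional _).aemeasurable
      hF.aestronglyMeasurable]
    simp
  rw [h2, h1, integral_smul_measure, ENNReal.toReal_ofReal (abs_nonneg _), real_smul, ← mul_assoc,
    ← ofReal_mul, ← abs_mul, mul_inv_cancel₀ hA]
  simp

/-- Poisson summation for the lattice `shWℤⁿ` and the semiclassical Fourier transform. -/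
theorem hasSum_scFT_dual_lattice {n : ℕ} {f : (Fin n → ℝ) → ℂ} (hf : ContDiff ℝ (⊤ : ℕ∞) f)
    (hfc : HasCompactSupport f) {W : Matrix (Fin n) (Fin n) ℝ} (hW : IsUnit W.det) {s h : ℝ}
    (hs : 0 < s) (hh : 0 < h) (ξ : Fin n → ℝ) :
    HasSum (fun m : Fin n → ℤ =>
      scFT h f (ξ + (2 * Real.pi / s) • (W.transpose)⁻¹.mulVec (fun j => (m j : ℝ))))
      (((|W.det| * (s * h) ^ n : ℝ) : ℂ) * ∑' k : Fin n → ℤ,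
        exp (((-(dotp ((s * h) • W.mulVec (fun j => (k j : ℝ))) ξ) / h : ℝ) : ℂ) * I) *
          f ((s * h) • W.mulVec (fun j => (k j : ℝ)))) := by
  have hsh : 0 < s * h := mul_pos hs hh
  set A : Matrix (Fin n) (Fin n) ℝ := (s * h) • W with hA
  have hAdet : A.det = (s * h) ^ n * W.det := by rw [hA, Matrix.det_smul, Fintype.card_fin]
  have hA0 : A.det ≠ 0 := by rw [hAdet]; exact mul_ne_zero (by positivity) hW.ne_zero
  have habs : |A.det| = |W.det| * (s * h) ^ n := by
    rw [hAdet, abs_mul, abs_of_pos (by positivity), mul_comm]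
  have hAv : ∀ y, A.mulVec y = (s * h) • W.mulVec y := fun y => Matrix.smul_mulVec _ _ _
  set ψ : (Fin n → ℝ) → ℂ := fun x => exp (((-(dotp x ξ) / h : ℝ) : ℂ) * I) * f x with hψ
  have hψs : ContDiff ℝ (⊤ : ℕ∞) ψ := by
    refine ContDiff.mul (ContDiff.cexp (ContDiff.mul (ofRealCLM.contDiff.comp ?_) contDiff_const)) hf
    unfold dotp
    exact ContDiff.div_const (by fun_prop) h
  set φ : (Fin n → ℝ) → ℂ := fun y => ψ (A.mulVec y) with hφ
  have hAlin : ContDiff ℝ (⊤ : ℕ∞) fun y => A.mulVec y := by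
    exact (LinearMap.toContinuousLinearMap (Matrix.toLin' A)).contDiff
  have hφs : ContDiff ℝ (⊤ : ℕ∞) φ := hψs.comp hAlin
  have hAinv : ∀ y, A⁻¹.mulVec (A.mulVec y) = y := fun y => by
    rw [Matrix.mulVec_mulVec, Matrix.nonsing_inv_mul _ (isUnit_iff_ne_zero.2 hA0), Matrix.one_mulVec]
  have hφc : HasCompactSupport φ := by
    have hc : Continuous fun y => A⁻¹.mulVec y := by fun_prop
    refine HasCompactSupport.intro (hfc.isCompact.image hc) fun y hy => ?_
    have : f (A.mulVec y) = 0 :=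
      image_eq_zero_of_notMem_tsupport fun h' => hy ⟨_, h', hAinv y⟩
    simp [hφ, hψ, this]
  have hdual : ∀ (y : Fin n → ℝ) (m : Fin n → ℤ),
      dotp (A.mulVec y) ((2 * Real.pi / s) • (W.transpose)⁻¹.mulVec (fun j => (m j : ℝ))) / h =
        2 * Real.pi * dotp y (fun j => (m j : ℝ)) := by
    intro y m
    have : dotp (W.mulVec y) ((W.transpose)⁻¹.mulVec (fun j => (m j : ℝ))) =
        dotp y (fun j => (m j : ℝ)) := by
      change W.mulVec y ⬝ᵥ _ = y ⬝ᵥ _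
      rw [Matrix.dotProduct_mulVec, ← Matrix.transpose_nonsing_inv, Matrix.vecMul_transpose,
        Matrix.mulVec_mulVec, Matrix.nonsing_inv_mul _ hW, Matrix.one_mulVec]
    rw [hAv, dotp_smul_left, dotp_smul_right, this]
    field_simp
  have hterm : ∀ m : Fin n → ℤ,
      ((|A.det| : ℝ) : ℂ) * scFT 1 φ ((2 * Real.pi) • fun i => (m i : ℝ)) =
      scFT h f (ξ + (2 * Real.pi / s) • (W.transpose)⁻¹.mulVec (fun j => (m j : ℝ))) := by
    intro m
    set b := (2 * Real.pi / s) • (W.transpose)⁻¹.mulVec (fun j => (m j : ℝ)) with hb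
    have hcont : Continuous fun x => exp (((-(dotp x (ξ + b)) / h : ℝ) : ℂ) * I) * f x := by
      have := hf.continuous
      fun_prop
    rw [scFT, scFT, ← abs_det_mul_integral_mulVec hA0 hcont]
    congr 2
    ext y
    simp only [hφ, hψ]
    rw [← mul_assoc, ← Complex.exp_add, dotp_smul_right, ← hdual y m, ← hb, dotp_add_right]
    congr 2
    push_cast
    ring
  have hs1 := summable_scFT_two_pi_intCast hφs hφc
  have h1 := (hs1.hasSum.mul_left ((|A.det| : ℝ) : ℂ))
  rw [← tsum_intCast_eq_tsum_scFT hφs.continuous hφc hs1] at h1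
  simp only [hterm] at h1
  simp only [habs, hφ, hψ, hAv] at h1
  exact h1

/-- The inverse of the semiclassical Fourier transform. -/
noncomputable def scInvFT {n : ℕ} (h : ℝ) (g : (Fin n → ℝ) → ℂ) (x : Fin n → ℝ) : ℂ :=
  (((2 * Real.pi * h) ^ n)⁻¹ : ℝ) • ∫ ξ : Fin n → ℝ, exp (((dotp x ξ / h : ℝ) : ℂ) * I) * g ξ

section Plancherel

open scoped FourierTransform SchwartzMap

theorem dotp_ofLp_eq_inner {n : ℕ} (v w : EuclideanSpace ℝ (Fin n)) :
    dotp v.ofLp w.ofLp = inner ℝ v w := by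
  simp [dotp, PiLp.inner_apply, mul_comm]

theorem integral_comp_ofLp {n : ℕ} {E : Type*} [NormedAddCommGroup E] [NormedSpace ℝ E]
    (F : (Fin n → ℝ) → E) : ∫ v : EuclideanSpace ℝ (Fin n), F v.ofLp = ∫ x, F x :=
  (PiLp.volume_preserving_ofLp (Fin n)).integral_comp
    (MeasurableEquiv.toLp 2 (Fin n → ℝ)).symm.measurableEmbedding F

theorem integral_comp_ofLp_smul {n : ℕ} {E : Type*} [NormedAddCommGroup E] [NormedSpace ℝ E]
    {c : ℝ} (hc : 0 < c) (F : (Fin n → ℝ) → E) :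
    ∫ v : EuclideanSpace ℝ (Fin n), F (c • v.ofLp) = (c ^ n)⁻¹ • ∫ x, F x := by
  rw [integral_comp_ofLp fun x => F (c • x), Measure.integral_comp_smul, abs_of_pos (by positivity)]
  simp

theorem fourier_comp_ofLp {n : ℕ} {h : ℝ} (hh : 0 < h) (f : (Fin n → ℝ) → ℂ)
    (w : EuclideanSpace ℝ (Fin n)) :
    𝓕 (fun v : EuclideanSpace ℝ (Fin n) => f v.ofLp) w = scFT h f ((2 * Real.pi * h) • w.ofLp) := by
  rw [Real.fourier_eq', scFT, ← integral_comp_ofLp]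
  congr 1
  ext v
  rw [dotp_smul_right, dotp_ofLp_eq_inner, smul_eq_mul]
  congr 4
  field_simp

theorem fourierInv_comp_ofLp_smul {n : ℕ} {h : ℝ} (hh : 0 < h) (g : (Fin n → ℝ) → ℂ)
    (v : EuclideanSpace ℝ (Fin n)) :
    𝓕⁻ (fun w : EuclideanSpace ℝ (Fin n) => g ((2 * Real.pi * h) • w.ofLp)) v =
      scInvFT h g v.ofLp := by
  rw [Real.fourierInv_eq', scInvFT, ← integral_comp_ofLp_smul (by positivity)]
  congr 1
  ext w
  rw [dotp_smul_right, dotp_ofLp_eq_inner, smul_eq_mul, real_inner_comm]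
  congr 4
  field_simp

/-- A smooth compactly supported function on `Fin n → ℝ` as a Schwartz function on Euclidean
space. -/
noncomputable def euclideanSchwartz {n : ℕ} {f : (Fin n → ℝ) → ℂ} (hf : ContDiff ℝ (⊤ : ℕ∞) f)
    (hfc : HasCompactSupport f) : 𝓢(EuclideanSpace ℝ (Fin n), ℂ) :=
  HasCompactSupport.toSchwartzMap (f := fun v : EuclideanSpace ℝ (Fin n) => f v.ofLp)
    (hfc.comp_homeomorph (EuclideanSpace.equiv (Fin n) ℝ).toHomeomorph)
    (hf.comp (EuclideanSpace.equiv (Fin n) ℝ).contDiff)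

theorem scInvFT_scFT {n : ℕ} {h : ℝ} (hh : 0 < h) {f : (Fin n → ℝ) → ℂ}
    (hf : ContDiff ℝ (⊤ : ℕ∞) f) (hfc : HasCompactSupport f) (x : Fin n → ℝ) :
    scInvFT h (scFT h f) x = f x := by
  have h1 := fourierInv_comp_ofLp_smul hh (scFT h f) (WithLp.toLp 2 x)
  simp only [← fourier_comp_ofLp hh] at h1
  rw [← h1]
  have h2 : 𝓕⁻ (𝓕 (euclideanSchwartz hf hfc)) = euclideanSchwartz hf hfc :=
    FourierPair.fourierInv_fourier_eq _
  have h3 := congrArg (fun F : 𝓢(EuclideanSpace ℝ (Fin n), ℂ) => F (WithLp.toLp 2 x)) h2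
  simp only [SchwartzMap.fourierInv_coe] at h3
  exact h3

theorem integral_norm_sq_sub_scInvFT {n : ℕ} {h : ℝ} (hh : 0 < h) {f g : (Fin n → ℝ) → ℂ}
    (hf : ContDiff ℝ (⊤ : ℕ∞) f) (hfc : HasCompactSupport f)
    (hg : ContDiff ℝ (⊤ : ℕ∞) g) (hgc : HasCompactSupport g) :
    ∫ x, ‖f x - scInvFT h g x‖ ^ 2 =
      ((2 * Real.pi * h) ^ n)⁻¹ * ∫ ξ, ‖scFT h f ξ - g ξ‖ ^ 2 := by
  have hc : 0 < 2 * Real.pi * h := by positivity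
  have hg' : ContDiff ℝ (⊤ : ℕ∞) fun x => g ((2 * Real.pi * h) • x) :=
    hg.comp (contDiff_const_smul _)
  have hgc' : HasCompactSupport fun x => g ((2 * Real.pi * h) • x) :=
    hgc.comp_homeomorph (Homeomorph.smulOfNeZero _ hc.ne')
  set F := euclideanSchwartz hf hfc
  set G := euclideanSchwartz hg' hgc'
  have h1 := SchwartzMap.integral_norm_sq_fourier (F - 𝓕⁻ G)
  have h2 : 𝓕 (F - 𝓕⁻ G) = 𝓕 F - G := by
    
    have := map_sub (FourierTransform.fourierCLM ℂ 𝓢(EuclideanSpace ℝ (Fin n), ℂ)) F (𝓕⁻ G)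
    simpa [FourierInvPair.fourier_fourierInv_eq] using this
  rw [h2] at h1
  have h3 : ∀ w, (𝓕 F - G) w =
      (fun ξ => scFT h f ξ - g ξ) ((2 * Real.pi * h) • w.ofLp) := fun w => by
    simp only [sub_apply, SchwartzMap.fourier_coe, ← fourier_comp_ofLp hh]
    rfl
  have h4 : ∀ v, (F - 𝓕⁻ G) v = (fun x => f x - scInvFT h g x) v.ofLp := fun v => by
    simp only [sub_apply, SchwartzMap.fourierInv_coe, ← fourierInv_comp_ofLp_smul hh]
    rfl
  simp only [h3, h4] at h1
  rw [integral_comp_ofLp_smul hc fun ξ => ‖scFT h f ξ - g ξ‖ ^ 2,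
    integral_comp_ofLp fun x => ‖f x - scInvFT h g x‖ ^ 2] at h1
  rw [← h1, smul_eq_mul]

end Plancherel

theorem integrable_one_add_norm_pow_inv (n : ℕ) :
    Integrable fun x : Fin n → ℝ => ((1 + ‖x‖) ^ (n + 1))⁻¹ := by
  have := integrable_one_add_norm (μ := (volume : Measure (Fin n → ℝ))) (r := (n + 1 : ℕ)) (by simp)
  refine this.congr (Filter.Eventually.of_forall fun x => ?_)
  simp only
  rw [Real.rpow_neg (by positivity), Real.rpow_natCast]

theorem integrable_of_one_add_norm_pow_mul_le {n : ℕ} {E : Type*} [NormedAddCommGroup E]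
    {F : (Fin n → ℝ) → E} (hF : Continuous F) {C : ℝ}
    (hC : ∀ ξ, (1 + ‖ξ‖) ^ (n + 1) * ‖F ξ‖ ≤ C) : Integrable F := by
  refine ((integrable_one_add_norm_pow_inv n).const_mul C).mono' hF.aestronglyMeasurable
    (Filter.Eventually.of_forall fun ξ => ?_)
  rw [← div_eq_mul_inv, le_div_iff₀ (by positivity), mul_comm]
  exact hC ξ

theorem integral_le_of_one_add_norm_pow_mul_le {n : ℕ} {E : Type*} [NormedAddCommGroup E]
    {F : (Fin n → ℝ) → E} {C : ℝ} (hC : ∀ ξ, (1 + ‖ξ‖) ^ (n + 1) * ‖F ξ‖ ≤ C) :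
    ∫ ξ, ‖F ξ‖ ≤ C * ∫ x : Fin n → ℝ, ((1 + ‖x‖) ^ (n + 1))⁻¹ := by
  rw [← integral_const_mul]
  refine integral_mono_of_nonneg (Filter.Eventually.of_forall fun ξ => norm_nonneg _)
    ((integrable_one_add_norm_pow_inv n).const_mul C) (Filter.Eventually.of_forall fun ξ => ?_)
  simp only
  rw [← div_eq_mul_inv, le_div_iff₀ (by positivity), mul_comm]
  exact hC ξ

theorem integral_mul_le_sqrt_mul_sqrt {α : Type*} {m : MeasurableSpace α} {μ : Measure α}
    {f g : α → ℝ} (hf : ∀ x, 0 ≤ f x) (hg : ∀ x, 0 ≤ g x) (hfm : AEStronglyMeasurable f μ)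
    (hgm : AEStronglyMeasurable g μ) (hfi : Integrable (fun x => f x ^ 2) μ)
    (hgi : Integrable (fun x => g x ^ 2) μ) :
    ∫ x, f x * g x ∂μ ≤ √(∫ x, f x ^ 2 ∂μ) * √(∫ x, g x ^ 2 ∂μ) := by
  have := integral_mul_le_Lp_mul_Lq_of_nonneg (μ := μ) Real.HolderConjugate.two_two
    (Filter.Eventually.of_forall hf) (Filter.Eventually.of_forall hg)
    (by simpa using (memLp_two_iff_integrable_sq hfm).2 hfi)
    (by simpa using (memLp_two_iff_integrable_sq hgm).2 hgi)
  simpa [Real.sqrt_eq_rpow] using this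

theorem integral_norm_le_sqrt_mul_sqrt {n : ℕ} {Ω : Set (Fin n → ℝ)} (hΩ : MeasurableSet Ω)
    (hΩb : Bornology.IsBounded Ω) {f : (Fin n → ℝ) → ℂ} (hf : Continuous f)
    (hfc : HasCompactSupport f) (hfΩ : ∀ x ∉ Ω, f x = 0) :
    ∫ x, ‖f x‖ ≤ √(volume.real Ω) * √(∫ x, ‖f x‖ ^ 2) := by
  have hfin : volume Ω ≠ ⊤ := hΩb.measure_lt_top.ne
  have hsq : (fun x => (Ω.indicator (fun _ => (1 : ℝ)) x) ^ 2) = Ω.indicator fun _ => 1 := by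
    ext x; by_cases hx : x ∈ Ω <;> simp [hx]
  have h1 := integral_mul_le_sqrt_mul_sqrt (μ := volume)
    (f := Ω.indicator fun _ => (1 : ℝ)) (g := fun x => ‖f x‖)
    (fun x => Set.indicator_nonneg (fun _ _ => zero_le_one) x) (fun x => norm_nonneg _)
    (aestronglyMeasurable_const.indicator hΩ) hf.norm.aestronglyMeasurable
    (by rw [hsq]; exact (integrable_indicator_iff hΩ).2 (integrableOn_const hfin))
    ((hf.norm.pow 2).integrable_of_hasCompactSupport
      (HasCompactSupport.intro hfc.isCompact fun x hx => by
        simp [image_eq_zero_of_notMem_tsupport hx]))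
  rw [hsq, integral_indicator hΩ, setIntegral_const, smul_eq_mul, mul_one] at h1
  refine le_trans (le_of_eq (integral_congr_ae (Filter.Eventually.of_forall fun x => ?_))) h1
  by_cases hx : x ∈ Ω <;> simp [hx, hfΩ x]

theorem integrable_exp_mul {n : ℕ} {g : (Fin n → ℝ) → ℂ} (hg : Integrable g) {a : (Fin n → ℝ) → ℝ}
    (ha : Continuous a) : Integrable fun x => exp ((a x : ℂ) * I) * g x := by
  refine hg.norm.mono' ((by fun_prop : Continuous fun x => exp ((a x : ℂ) * I)).aestronglyMeasurable.mul
    hg.aestronglyMeasurable) (Filter.Eventually.of_forall fun x => ?_)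
  rw [norm_exp_ofReal_mul_I_mul]

theorem scFT_sub {n : ℕ} (h : ℝ) {f g : (Fin n → ℝ) → ℂ} (hf : Integrable f) (hg : Integrable g)
    (ξ : Fin n → ℝ) : scFT h (fun x => f x - g x) ξ = scFT h f ξ - scFT h g ξ := by
  simp only [scFT, mul_sub]
  exact integral_sub (integrable_exp_mul hf (by fun_prop)) (integrable_exp_mul hg (by fun_prop))

theorem continuous_scFT {n : ℕ} (h : ℝ) {g : (Fin n → ℝ) → ℂ} (hg : Integrable g) :
    Continuous (scFT h g) := by
  refine continuous_of_dominated (bound := fun x => ‖g x‖)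
    (fun ξ => (integrable_exp_mul hg (by fun_prop)).aestronglyMeasurable)
    (fun ξ => Filter.Eventually.of_forall fun x => (norm_exp_ofReal_mul_I_mul _ _).le) hg.norm
    (Filter.Eventually.of_forall fun x => by fun_prop)

theorem scOp_eq_scInvFT {n : ℕ} (h : ℝ) (ψ : (Fin n → ℝ) → (Fin n → ℝ) → ℂ)
    (f : (Fin n → ℝ) → ℂ) (x : Fin n → ℝ) :
    scOp h ψ f x = scInvFT h (fun ξ => ψ x ξ * scFT h f ξ) x := by
  rw [scOp, scInvFT, zpow_neg, zpow_natCast]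
  congr 2
  ext ξ
  rw [scFT, ← mul_assoc, ← integral_const_mul]
  congr 1
  ext y
  have : exp (((dotp (x - y) ξ / h : ℝ) : ℂ) * I) =
      exp (((dotp x ξ / h : ℝ) : ℂ) * I) * exp (((-(dotp y ξ) / h : ℝ) : ℂ) * I) := by
    rw [← Complex.exp_add, dotp_sub_left]
    congr 1
    push_cast
    ring
  rw [this]
  ring

section Quantization

variable {n : ℕ} {ψ : (Fin n → ℝ) → (Fin n → ℝ) → ℂ}

theorem integrable_exp_mul_symbol
    (hψ : Continuous fun q : (Fin n → ℝ) × (Fin n → ℝ) => ψ q.1 q.2)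
    (hψc : HasCompactSupport fun q : (Fin n → ℝ) × (Fin n → ℝ) => ψ q.1 q.2) {h : ℝ}
    {f : (Fin n → ℝ) → ℂ} (hf : Integrable f) {a : (Fin n → ℝ) × (Fin n → ℝ) → ℝ}
    (ha : Continuous a) :
    Integrable (fun q : (Fin n → ℝ) × (Fin n → ℝ) =>
      exp ((a q : ℂ) * I) * (ψ q.1 q.2 * scFT h f q.2)) (volume.prod volume) := by
  have hc := continuous_scFT h hf
  have hcont : Continuous fun q : (Fin n → ℝ) × (Fin n → ℝ) =>
      exp ((a q : ℂ) * I) * (ψ q.1 q.2 * scFT h f q.2) :=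
    ((by fun_prop : Continuous fun q => exp ((a q : ℂ) * I))).mul (hψ.mul (hc.comp continuous_snd))
  refine hcont.integrable_of_hasCompactSupport (HasCompactSupport.intro hψc.isCompact fun q hq => ?_)
  have : ψ q.1 q.2 = 0 := image_eq_zero_of_notMem_tsupport
    (f := fun q : (Fin n → ℝ) × (Fin n → ℝ) => ψ q.1 q.2) hq
  rw [this, zero_mul, mul_zero]

theorem integrable_scOp (hψ : Continuous fun q : (Fin n → ℝ) × (Fin n → ℝ) => ψ q.1 q.2)
    (hψc : HasCompactSupport fun q : (Fin n → ℝ) × (Fin n → ℝ) => ψ q.1 q.2) (h : ℝ)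
    {f : (Fin n → ℝ) → ℂ} (hf : Integrable f) : Integrable (scOp h ψ f) := by
  have h1 := (integrable_exp_mul_symbol hψ hψc (h := h) hf
    (a := fun q => dotp q.1 q.2 / h) (by fun_prop)).integral_prod_left
  refine (h1.smul (((2 * Real.pi * h) ^ n)⁻¹ : ℝ)).congr (Filter.Eventually.of_forall fun x => ?_)
  rw [scOp_eq_scInvFT]
  rfl

theorem scFT_scOp (hψ : Continuous fun q : (Fin n → ℝ) × (Fin n → ℝ) => ψ q.1 q.2)
    (hψc : HasCompactSupport fun q : (Fin n → ℝ) × (Fin n → ℝ) => ψ q.1 q.2) (h : ℝ)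
    {f : (Fin n → ℝ) → ℂ} (hf : Integrable f) (η : Fin n → ℝ) :
    scFT h (scOp h ψ f) η = (((2 * Real.pi * h) ^ n)⁻¹ : ℝ) •
      ∫ ξ, scFT h f ξ * scFT 1 (fun x => ψ x ξ) (h⁻¹ • (η - ξ)) := by
  have h1 := integral_integral_swap (f := fun x ξ =>
    exp (((-(dotp x (h⁻¹ • (η - ξ))) : ℝ) : ℂ) * I) * (ψ x ξ * scFT h f ξ))
    (integrable_exp_mul_symbol hψ hψc (h := h) hf
      (a := fun q => -(dotp q.1 (h⁻¹ • (η - q.2)))) (by fun_prop))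
  have h2 : ∀ ξ, scFT h f ξ * scFT 1 (fun x => ψ x ξ) (h⁻¹ • (η - ξ)) =
      ∫ x, exp (((-(dotp x (h⁻¹ • (η - ξ))) : ℝ) : ℂ) * I) * (ψ x ξ * scFT h f ξ) := by
    intro ξ
    rw [scFT.eq_1 1, ← integral_const_mul]
    congr 1
    ext x
    rw [div_one]
    ring
  simp only [h2]
  rw [← h1, scFT, ← integral_smul]
  congr 1
  ext x
  rw [scOp_eq_scInvFT, scInvFT, mul_smul_comm, ← integral_const_mul]
  congr 2
  ext ξ
  rw [← mul_assoc, ← Complex.exp_add]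
  congr 2
  rw [dotp_smul_right, dotp_sub_right]
  push_cast
  ring

/-- Off-diagonal decay of `g · F_h ψ(x,hD)` for `g` vanishing to order `M` on the `ξ`-support
of `ψ`. -/
theorem exists_forall_one_add_norm_pow_mul_scFT_scOp_le
    (hψ : ContDiff ℝ (⊤ : ℕ∞) fun q : (Fin n → ℝ) × (Fin n → ℝ) => ψ q.1 q.2)
    (hψc : HasCompactSupport fun q : (Fin n → ℝ) × (Fin n → ℝ) => ψ q.1 q.2) (p M : ℕ)
    {g : (Fin n → ℝ) → ℂ} {C' : ℝ}
    (hg : ∀ ξ, (∃ x, ψ x ξ ≠ 0) → ∀ η, ‖g η‖ ≤ C' * ‖η - ξ‖ ^ M) :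
    ∃ C : ℝ, 0 ≤ C ∧ ∀ h ∈ Set.Ioc (0 : ℝ) 1, ∀ f : (Fin n → ℝ) → ℂ, Integrable f → ∀ η,
      (1 + ‖η‖) ^ p * ‖g η * scFT h (scOp h ψ f) η‖ ≤ C * h ^ M * (h ^ n)⁻¹ * ∫ x, ‖f x‖ := by
  obtain ⟨CΨ, hCΨ0, hCΨ⟩ := exists_forall_one_add_norm_pow_mul_scFT_slice_le (p + M) hψ hψc
  obtain ⟨R, hR⟩ := (hψc.isCompact.image continuous_snd).isBounded.subset_closedBall 0
  have hsupp : ∀ ξ ∉ Metric.closedBall (0 : Fin n → ℝ) R, ∀ x, ψ x ξ = 0 := fun ξ hξ x =>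
    image_eq_zero_of_notMem_tsupport (f := fun q : (Fin n → ℝ) × (Fin n → ℝ) => ψ q.1 q.2)
      (x := (x, ξ)) fun h' => hξ (hR ⟨_, h', rfl⟩)
  set D := (1 + |R|) ^ p * |C'| * CΨ with hD
  have hD0 : 0 ≤ D := by positivity
  refine ⟨((2 * Real.pi) ^ n)⁻¹ * (volume.real (Metric.closedBall (0 : Fin n → ℝ) R) * D),
    by positivity, fun h hh f hf η => ?_⟩
  have hh0 : 0 < h := hh.1
  set L := ∫ x, ‖f x‖ with hL
  have hL0 : 0 ≤ L := integral_nonneg fun _ => norm_nonneg _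
  have hpt : ∀ ξ, (1 + ‖η‖) ^ p *
      ‖g η * (scFT h f ξ * scFT 1 (fun x => ψ x ξ) (h⁻¹ • (η - ξ)))‖ ≤
      (Metric.closedBall (0 : Fin n → ℝ) R).indicator (fun _ => D * h ^ M * L) ξ := by
    intro ξ
    by_cases hex : ∃ x, ψ x ξ ≠ 0
    · have hξ : ξ ∈ Metric.closedBall (0 : Fin n → ℝ) R := by
        by_contra hc
        obtain ⟨x, hx⟩ := hex
        exact hx (hsupp ξ hc x)
      rw [Set.indicator_of_mem hξ]
      set θ := h⁻¹ • (η - ξ) with hθ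
      have hηξ : ‖η - ξ‖ = h * ‖θ‖ := by
        rw [hθ, norm_smul, norm_inv, Real.norm_of_nonneg hh0.le]; field_simp
      have e1 : 1 + ‖η‖ ≤ (1 + |R|) * (1 + ‖θ‖) := by
        have a1 : ‖η‖ ≤ ‖η - ξ‖ + ‖ξ‖ := by simpa using norm_add_le (η - ξ) ξ
        have a2 : ‖ξ‖ ≤ |R| := (by simpa using hξ : ‖ξ‖ ≤ R).trans (le_abs_self R)
        have a3 : h * ‖θ‖ ≤ 1 * ‖θ‖ := by gcongr; exact hh.2
        nlinarith [norm_nonneg θ, abs_nonneg R, mul_nonneg (abs_nonneg R) (norm_nonneg θ)]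
      have e2 : ‖g η‖ ≤ |C'| * (h ^ M * (1 + ‖θ‖) ^ M) := by
        refine (hg ξ hex η).trans ?_
        rw [hηξ, mul_pow]
        gcongr
        · exact le_abs_self C'
        · linarith
      have e3 := norm_scFT_le h f ξ
      have e4 := hCΨ θ ξ
      calc (1 + ‖η‖) ^ p * ‖g η * (scFT h f ξ * scFT 1 (fun x => ψ x ξ) θ)‖
          ≤ ((1 + |R|) ^ p * (1 + ‖θ‖) ^ p) * ((|C'| * (h ^ M * (1 + ‖θ‖) ^ M)) *
            (L * ‖scFT 1 (fun x => ψ x ξ) θ‖)) := by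
            rw [norm_mul, norm_mul, ← mul_pow]; gcongr
        _ = (1 + |R|) ^ p * |C'| * h ^ M * L *
            ((1 + ‖θ‖) ^ (p + M) * ‖scFT 1 (fun x => ψ x ξ) θ‖) := by ring
        _ ≤ (1 + |R|) ^ p * |C'| * h ^ M * L * CΨ := by gcongr
        _ = D * h ^ M * L := by rw [hD]; ring
    · push Not at hex
      have : scFT 1 (fun x => ψ x ξ) (h⁻¹ • (η - ξ)) = 0 := by simp [scFT, hex]
      rw [this, mul_zero, mul_zero, norm_zero, mul_zero]
      exact Set.indicator_nonneg (fun _ _ => by positivity) _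
  have hint := norm_integral_le_of_norm_le (μ := volume)
    (f := fun ξ => ((1 + ‖η‖) ^ p : ℝ) • (g η * (scFT h f ξ * scFT 1 (fun x => ψ x ξ) (h⁻¹ • (η - ξ)))))
    ((integrable_indicator_iff Metric.isClosed_closedBall.measurableSet).2 (integrableOn_const
      (C := D * h ^ M * L) (measure_closedBall_lt_top (x := (0 : Fin n → ℝ)) (r := R)).ne))
    (Filter.Eventually.of_forall fun ξ => by
      rw [norm_smul, Real.norm_of_nonneg (by positivity)]; exact hpt ξ)
  rw [integral_indicator Metric.isClosed_closedBall.measurableSet, setIntegral_const, smul_eq_mul,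
    integral_smul, integral_const_mul, norm_smul, Real.norm_of_nonneg (by positivity)] at hint
  rw [scFT_scOp hψ.continuous hψc h hf, mul_smul_comm, norm_smul,
    Real.norm_of_nonneg (by positivity)]
  calc _ = ((2 * Real.pi * h) ^ n)⁻¹ * ((1 + ‖η‖) ^ p *
        ‖g η * ∫ ξ, scFT h f ξ * scFT 1 (fun x => ψ x ξ) (h⁻¹ • (η - ξ))‖) := by ring
    _ ≤ ((2 * Real.pi * h) ^ n)⁻¹ *
        (volume.real (Metric.closedBall (0 : Fin n → ℝ) R) * (D * h ^ M * L)) := by gcongr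
    _ = _ := by rw [mul_pow, mul_inv]; ring

end Quantization

theorem one_add_norm_sq_le_two_mul {n : ℕ} (ξ : Fin n → ℝ) :
    (1 + ‖ξ‖) ^ 2 ≤ 2 * (1 + ∑ j, ξ j ^ 2) := by
  have h0 : 0 ≤ ∑ j, ξ j ^ 2 := Finset.sum_nonneg fun j _ => sq_nonneg _
  have h : ‖ξ‖ ≤ √(∑ j, ξ j ^ 2) := (pi_norm_le_iff_of_nonneg (Real.sqrt_nonneg _)).2 fun j => by
    rw [Real.norm_eq_abs]
    exact Real.abs_le_sqrt (Finset.single_le_sum (f := fun j => ξ j ^ 2)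
      (fun j _ => sq_nonneg _) (Finset.mem_univ j))
  have h2 : ‖ξ‖ ^ 2 ≤ ∑ j, ξ j ^ 2 := (Real.le_sqrt (norm_nonneg _) h0).1 h
  nlinarith [sq_nonneg (1 - ‖ξ‖)]

theorem one_add_sum_sq_le {n : ℕ} (ξ : Fin n → ℝ) :
    1 + ∑ j, ξ j ^ 2 ≤ (n + 1) * (1 + ‖ξ‖) ^ 2 := by
  have h : ∑ j, ξ j ^ 2 ≤ ∑ _j : Fin n, ‖ξ‖ ^ 2 := Finset.sum_le_sum fun j _ => by
    rw [← sq_abs, ← Real.norm_eq_abs]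
    gcongr
    exact norm_le_pi_norm ξ j
  rw [Finset.sum_const, Finset.card_univ, Fintype.card_fin, nsmul_eq_mul] at h
  have := norm_nonneg ξ
  have hn : (0 : ℝ) ≤ n := n.cast_nonneg
  nlinarith [mul_nonneg hn this]

theorem integral_norm_scFT_le_hSobSq {n : ℕ} {h : ℝ} (hh : h ∈ Set.Ioc (0 : ℝ) 1)
    {e : (Fin n → ℝ) → ℂ} (he : Integrable e)
    (hdec : ∀ p : ℕ, ∃ C : ℝ, ∀ ξ, (1 + ‖ξ‖) ^ p * ‖scFT h e ξ‖ ≤ C) :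
    Integrable (scFT h e) ∧
    ∫ ξ, ‖scFT h e ξ‖ ≤ √(∫ ξ : Fin n → ℝ, ((1 + ∑ j, ξ j ^ 2) ^ (n + 1))⁻¹) *
      √((2 * Real.pi) ^ n) * √(hSobSq n h ((n + 1 : ℕ) : ℝ) e) := by
  have hh0 : 0 < h := hh.1
  have hc := continuous_scFT h he
  have hpos : ∀ ξ : Fin n → ℝ, 0 < 1 + ∑ j, ξ j ^ 2 := fun ξ => by
    have := Finset.sum_nonneg fun j (_ : j ∈ Finset.univ) => sq_nonneg (ξ j)
    linarith
  have hsqcont : Continuous fun ξ : Fin n → ℝ => √((1 + ∑ j, ξ j ^ 2) ^ (n + 1)) := by fun_prop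
  have hsqpos : ∀ ξ : Fin n → ℝ, 0 < √((1 + ∑ j, ξ j ^ 2) ^ (n + 1)) :=
    fun ξ => Real.sqrt_pos.2 (pow_pos (hpos ξ) _)
  refine ⟨integrable_of_one_add_norm_pow_mul_le hc (hdec (n + 1)).choose_spec, ?_⟩
  have hi1 : Integrable fun ξ : Fin n → ℝ => ((1 + ∑ j, ξ j ^ 2) ^ (n + 1))⁻¹ := by
    refine integrable_of_one_add_norm_pow_mul_le (C := 2 ^ (n + 1))
      (Continuous.inv₀ (by fun_prop) fun ξ => (pow_pos (hpos ξ) _).ne') fun ξ => ?_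
    have hp := hpos ξ
    rw [Real.norm_of_nonneg (by positivity), ← div_eq_mul_inv, div_le_iff₀ (by positivity),
      ← mul_pow]
    gcongr
    refine le_trans ?_ (one_add_norm_sq_le_two_mul ξ)
    nlinarith [norm_nonneg ξ]
  have hi2 : Integrable fun ξ : Fin n → ℝ => (1 + ∑ j, ξ j ^ 2) ^ (n + 1) * ‖scFT h e ξ‖ ^ 2 := by
    obtain ⟨C, hC⟩ := hdec (2 * (n + 1))
    refine integrable_of_one_add_norm_pow_mul_le (C := (n + 1) ^ (n + 1) * C ^ 2)
      (by fun_prop) fun ξ => ?_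
    have hp := hpos ξ
    rw [Real.norm_of_nonneg (by positivity)]
    calc (1 + ‖ξ‖) ^ (n + 1) * ((1 + ∑ j, ξ j ^ 2) ^ (n + 1) * ‖scFT h e ξ‖ ^ 2)
        ≤ ((1 + ‖ξ‖) ^ 2) ^ (n + 1) * ((((n + 1) * (1 + ‖ξ‖) ^ 2)) ^ (n + 1) *
            ‖scFT h e ξ‖ ^ 2) := by
          gcongr
          · nlinarith [norm_nonneg ξ]
          · exact one_add_sum_sq_le ξ
      _ = (n + 1) ^ (n + 1) * ((1 + ‖ξ‖) ^ (2 * (n + 1)) * ‖scFT h e ξ‖) ^ 2 := by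
          rw [mul_pow _ _ (n + 1), mul_pow _ _ 2, ← pow_mul, ← pow_mul]; ring
      _ ≤ _ := by gcongr; exact hC ξ
  have hcs := integral_mul_le_sqrt_mul_sqrt (μ := volume)
    (f := fun ξ : Fin n → ℝ => (√((1 + ∑ j, ξ j ^ 2) ^ (n + 1)))⁻¹)
    (g := fun ξ => √((1 + ∑ j, ξ j ^ 2) ^ (n + 1)) * ‖scFT h e ξ‖)
    (fun ξ => by positivity) (fun ξ => by positivity)
    (hsqcont.inv₀ fun ξ => (hsqpos ξ).ne').aestronglyMeasurable
    (hsqcont.mul hc.norm).aestronglyMeasurable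
    (by simpa only [inv_pow, Real.sq_sqrt (pow_pos (hpos _) _).le] using hi1)
    (by simpa only [mul_pow, Real.sq_sqrt (pow_pos (hpos _) _).le] using hi2)
  simp only [inv_pow, mul_pow, Real.sq_sqrt (pow_pos (hpos _) _).le,
    inv_mul_cancel_left₀ (hsqpos _).ne'] at hcs
  refine hcs.trans ?_
  rw [mul_assoc]
  gcongr
  rw [← Real.sqrt_mul (by positivity)]
  apply Real.sqrt_le_sqrt
  rw [hSobSq, zpow_neg, zpow_natCast]
  simp only [Real.rpow_natCast]
  set J := ∫ ξ : Fin n → ℝ, (1 + ∑ j, ξ j ^ 2) ^ (n + 1) * ‖scFT h e ξ‖ ^ 2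
  have hJ : 0 ≤ J := integral_nonneg fun ξ => by have := hpos ξ; positivity
  rw [mul_pow _ h, mul_inv, ← mul_assoc, ← mul_assoc, mul_inv_cancel₀ (by positivity), one_mul]
  exact le_mul_of_one_le_left hJ ((one_le_inv₀ (by positivity)).2 (pow_le_one₀ hh0.le hh.2))

theorem exists_forall_one_add_norm_pow_mul_scFT_le_of_mem_Ioc {n : ℕ} (p : ℕ)
    {f : (Fin n → ℝ) → ℂ} (hf : ContDiff ℝ (⊤ : ℕ∞) f) (hfc : HasCompactSupport f) {h : ℝ}
    (hh : h ∈ Set.Ioc (0 : ℝ) 1) : ∃ C : ℝ, ∀ ξ, (1 + ‖ξ‖) ^ p * ‖scFT h f ξ‖ ≤ C := by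
  obtain ⟨C, -, hC⟩ := exists_forall_one_add_norm_pow_mul_scFT_le p hf hfc
  refine ⟨C, fun ξ => le_trans ?_ (hC (h⁻¹ • ξ))⟩
  rw [scFT_eq_scFT_one h]
  gcongr
  rw [norm_smul, norm_inv, Real.norm_of_nonneg hh.1.le]
  exact le_mul_of_one_le_left (norm_nonneg _) ((one_le_inv₀ hh.1).2 hh.2)

/-- Away from the set where the frequency cutoff `χ` equals one, the semiclassical Fourier
transform of a localized family is negligible in `L¹`. -/
theorem exists_integral_one_sub_mul_scFT_le {n : ℕ} {Ω : Set (Fin n → ℝ)} (hΩo : IsOpen Ω)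
    (hΩb : Bornology.IsBounded Ω) {ψ : (Fin n → ℝ) → (Fin n → ℝ) → ℂ}
    (hψ : ContDiff ℝ (⊤ : ℕ∞) fun q : (Fin n → ℝ) × (Fin n → ℝ) => ψ q.1 q.2)
    (hψc : HasCompactSupport fun q : (Fin n → ℝ) × (Fin n → ℝ) => ψ q.1 q.2)
    {f : ℝ → (Fin n → ℝ) → ℂ}
    (hf : ∀ h ∈ Set.Ioc (0 : ℝ) 1, ContDiff ℝ (⊤ : ℕ∞) (f h) ∧ HasCompactSupport (f h))
    (hfΩ : ∀ h ∈ Set.Ioc (0 : ℝ) 1, ∀ x ∉ Ω, f h x = 0)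
    (hloc : ∀ m : ℝ, 0 ≤ m → ∀ N : ℕ, ∃ C : ℝ, ∀ h ∈ Set.Ioc (0 : ℝ) 1,
      √(hSobSq n h m (fun x => f h x - scOp h ψ (f h) x)) ≤
        C * h ^ N * √(∫ x : Fin n → ℝ, ‖f h x‖ ^ 2))
    {χ : (Fin n → ℝ) → ℂ} (hχ : ContDiff ℝ (⊤ : ℕ∞) χ) (hχc : HasCompactSupport χ)
    (hχψ : ∀ x ξ : Fin n → ℝ, χ ξ * ψ x ξ = ψ x ξ) (N : ℕ) :
    ∃ C : ℝ, 0 ≤ C ∧ ∀ h ∈ Set.Ioc (0 : ℝ) 1,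
      Integrable (fun ξ => (1 - χ ξ) * scFT h (f h) ξ) ∧
      ∫ ξ, ‖(1 - χ ξ) * scFT h (f h) ξ‖ ≤ C * h ^ N * √(∫ x, ‖f h x‖ ^ 2) := by
  obtain ⟨B, hB⟩ := hχc.exists_bound_of_continuous hχ.continuous
  have hgB : ∀ ξ, ‖1 - χ ξ‖ ≤ 1 + B := fun ξ =>
    (norm_sub_le _ _).trans (by simpa using hB ξ)
  have hB0 : 0 ≤ 1 + B := (norm_nonneg _).trans (hgB 0)
  have hK : IsOpen {ξ : Fin n → ℝ | ∃ x, ψ x ξ ≠ 0} := by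
    have := isOpenMap_snd _ (hψ.continuous.isOpen_preimage {0}ᶜ isOpen_compl_singleton)
    have he : {ξ : Fin n → ℝ | ∃ x, ψ x ξ ≠ 0} =
        Prod.snd '' ((fun q : (Fin n → ℝ) × (Fin n → ℝ) => ψ q.1 q.2) ⁻¹' {0}ᶜ) :=
      Set.ext fun ξ => ⟨fun ⟨x, hx⟩ => ⟨(x, ξ), hx, rfl⟩, fun ⟨q, hq, hqξ⟩ => ⟨q.1, hqξ ▸ hq⟩⟩
    rwa [he]
  obtain ⟨CT, -, hCT⟩ := exists_forall_norm_le_norm_sub_pow hK (N + n) (g := fun ξ => 1 - χ ξ)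
    (contDiff_const.sub hχ) (by
      have : fderiv ℝ (fun ξ => 1 - χ ξ) = -fderiv ℝ χ := by
        ext1 ξ; rw [fderiv_const_sub]; rfl
      rw [this]
      exact (hχc.fderiv ℝ).neg) ⟨1 + B, hgB⟩ (by
      rintro ξ ⟨x, hx⟩
      have := hχψ x ξ
      rw [mul_eq_right₀ hx] at this
      simp [this])
  obtain ⟨C1, hC10, hC1⟩ := exists_forall_one_add_norm_pow_mul_scFT_scOp_le hψ hψc (n + 1) (N + n)
    (g := fun ξ => 1 - χ ξ) (C' := CT) fun ξ hξ η => hCT ξ hξ η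
  obtain ⟨C2, hC2⟩ := hloc ((n + 1 : ℕ) : ℝ) (by positivity) N
  set a := √(∫ ξ : Fin n → ℝ, ((1 + ∑ j, ξ j ^ 2) ^ (n + 1))⁻¹) * √((2 * Real.pi) ^ n)
  set b := ∫ x : Fin n → ℝ, ((1 + ‖x‖) ^ (n + 1))⁻¹
  have hb : 0 ≤ b := integral_nonneg fun x => by positivity
  refine ⟨(1 + B) * (a * |C2|) + C1 * √(volume.real Ω) * b, by positivity, fun h hh => ?_⟩
  have hh0 : 0 < h := hh.1
  obtain ⟨hfs, hfc⟩ := hf h hh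
  have hfi : Integrable (f h) := hfs.continuous.integrable_of_hasCompactSupport hfc
  have hOi := integrable_scOp hψ.continuous hψc h hfi
  have hei : Integrable fun x => f h x - scOp h ψ (f h) x := hfi.sub hOi
  have hdec : ∀ p : ℕ, ∃ C : ℝ, ∀ ξ,
      (1 + ‖ξ‖) ^ p * ‖scFT h (fun x => f h x - scOp h ψ (f h) x) ξ‖ ≤ C := by
    intro p
    obtain ⟨C3, hC3⟩ := exists_forall_one_add_norm_pow_mul_scFT_le_of_mem_Ioc p hfs hfc hh
    obtain ⟨C4, -, hC4⟩ := exists_forall_one_add_norm_pow_mul_scFT_scOp_le hψ hψc p 0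
      (g := fun _ => 1) (C' := 1) (by simp)
    refine ⟨C3 + C4 * h ^ 0 * (h ^ n)⁻¹ * ∫ x, ‖f h x‖, fun ξ => ?_⟩
    rw [scFT_sub h hfi hOi]
    calc _ ≤ (1 + ‖ξ‖) ^ p * (‖scFT h (f h) ξ‖ + ‖scFT h (scOp h ψ (f h)) ξ‖) := by
          gcongr; exact norm_sub_le _ _
      _ ≤ _ := by
          rw [mul_add]
          refine add_le_add (hC3 ξ) ?_
          simpa only [one_mul] using hC4 h hh (f h) hfi ξ
  obtain ⟨hEi, hE⟩ := integral_norm_scFT_le_hSobSq hh hei hdec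
  set M := √(∫ x, ‖f h x‖ ^ 2)
  have hL : ∫ x, ‖f h x‖ ≤ √(volume.real Ω) * M :=
    integral_norm_le_sqrt_mul_sqrt hΩo.measurableSet hΩb hfs.continuous hfc (hfΩ h hh)
  have hsplit : ∀ ξ, (1 - χ ξ) * scFT h (f h) ξ =
      (1 - χ ξ) * scFT h (fun x => f h x - scOp h ψ (f h) x) ξ +
      (1 - χ ξ) * scFT h (scOp h ψ (f h)) ξ := fun ξ => by
    rw [scFT_sub h hfi hOi]; ring
  have hd : ∀ ξ, (1 + ‖ξ‖) ^ (n + 1) * ‖(1 - χ ξ) * scFT h (scOp h ψ (f h)) ξ‖ ≤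
      C1 * h ^ N * (√(volume.real Ω) * M) := fun ξ => by
    refine (hC1 h hh (f h) hfi ξ).trans ?_
    rw [pow_add, mul_assoc C1, mul_assoc (h ^ N), mul_inv_cancel₀ (by positivity), mul_one]
    gcongr
  have hgc : Continuous fun ξ => 1 - χ ξ := continuous_const.sub hχ.continuous
  have hi2 : Integrable fun ξ => (1 - χ ξ) * scFT h (scOp h ψ (f h)) ξ :=
    integrable_of_one_add_norm_pow_mul_le (hgc.mul (continuous_scFT h hOi)) hd
  have hi1 : Integrable fun ξ => (1 - χ ξ) * scFT h (fun x => f h x - scOp h ψ (f h) x) ξ :=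
    hEi.bdd_mul hgc.aestronglyMeasurable (Filter.Eventually.of_forall hgB)
  simp only [hsplit]
  refine ⟨hi1.add hi2, ?_⟩
  calc _ ≤ ∫ ξ, (‖(1 - χ ξ) * scFT h (fun x => f h x - scOp h ψ (f h) x) ξ‖ +
        ‖(1 - χ ξ) * scFT h (scOp h ψ (f h)) ξ‖) :=
        integral_mono (hi1.add hi2).norm (hi1.norm.add hi2.norm) fun ξ => norm_add_le _ _
    _ = (∫ ξ, ‖(1 - χ ξ) * scFT h (fun x => f h x - scOp h ψ (f h) x) ξ‖) +
        ∫ ξ, ‖(1 - χ ξ) * scFT h (scOp h ψ (f h)) ξ‖ := integral_add hi1.norm hi2.norm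
    _ ≤ (1 + B) * (a * (|C2| * h ^ N * M)) + C1 * h ^ N * (√(volume.real Ω) * M) * b := by
        refine add_le_add ?_ (integral_le_of_one_add_norm_pow_mul_le hd)
        calc _ ≤ ∫ ξ, (1 + B) * ‖scFT h (fun x => f h x - scOp h ψ (f h) x) ξ‖ :=
              integral_mono hi1.norm (hEi.norm.const_mul _) fun ξ => by
                simp only [norm_mul]; gcongr; exact hgB ξ
          _ ≤ _ := by
              rw [integral_const_mul]
              refine mul_le_mul_of_nonneg_left (hE.trans ?_) hB0
              refine mul_le_mul_of_nonneg_left ((hC2 h hh).trans ?_) (by positivity)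
              gcongr
              exact le_abs_self C2
    _ = _ := by ring

theorem exists_card_le_and_forall_notMem {n : ℕ} {Ω : Set (Fin n → ℝ)}
    (hΩb : Bornology.IsBounded Ω) {W : Matrix (Fin n) (Fin n) ℝ} (hW : IsUnit W.det) {s : ℝ}
    (hs : 0 < s) : ∃ C : ℝ, 0 ≤ C ∧ ∀ h ∈ Set.Ioc (0 : ℝ) 1, ∃ T : Finset (Fin n → ℤ),
      (T.card : ℝ) ≤ C * (h ^ n)⁻¹ ∧
        ∀ k ∉ T, (s * h) • W.mulVec (fun j => (k j : ℝ)) ∉ Ω := by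
  obtain ⟨R, hR⟩ := hΩb.subset_closedBall 0
  set A := LinearMap.toContinuousLinearMap (Matrix.toLin' W⁻¹) with hA
  set D := ‖A‖ * |R| / s with hD
  have hD0 : 0 ≤ D := by positivity
  refine ⟨(2 * D + 3) ^ n, by positivity, fun h hh => ?_⟩
  have hh0 : 0 < h := hh.1
  refine ⟨Fintype.piFinset fun _ => Finset.Icc (-(⌈D / h⌉₊ : ℤ)) ⌈D / h⌉₊, ?_, fun k hk hkΩ => hk ?_⟩
  · rw [Fintype.card_piFinset, Finset.prod_const, Finset.card_univ, Fintype.card_fin, Int.card_Icc]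
    have : ((⌈D / h⌉₊ : ℤ) + 1 - -(⌈D / h⌉₊ : ℤ)).toNat = 2 * ⌈D / h⌉₊ + 1 := by lia
    rw [this]
    push_cast
    rw [← inv_pow, ← mul_pow]
    gcongr
    have h1 := (Nat.ceil_lt_add_one (div_nonneg hD0 hh0.le)).le
    have h2 : 1 ≤ h⁻¹ := (one_le_inv₀ hh0).2 hh.2
    rw [div_eq_mul_inv] at h1
    rw [div_eq_mul_inv]
    linarith
  · have h1 : ‖(s * h) • W.mulVec (fun j => (k j : ℝ))‖ ≤ |R| :=
      (by simpa using hR hkΩ : ‖_‖ ≤ R).trans (le_abs_self R)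
    have h2 : (fun j => (k j : ℝ)) = A (W.mulVec fun j => (k j : ℝ)) := by
      simp [hA, Matrix.mulVec_mulVec, Matrix.nonsing_inv_mul _ hW]
    rw [norm_smul, Real.norm_of_nonneg (by positivity)] at h1
    have h3 : ‖fun j => (k j : ℝ)‖ ≤ D / h := by
      rw [h2, hD, div_div, le_div_iff₀ (by positivity)]
      refine (mul_le_mul_of_nonneg_right (A.le_opNorm _) (by positivity)).trans ?_
      rw [mul_assoc, mul_comm ‖W.mulVec _‖]
      gcongr
    rw [Fintype.mem_piFinset]
    intro j
    have h4 : |(k j : ℝ)| ≤ ⌈D / h⌉₊ :=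
      ((norm_le_pi_norm (fun j => (k j : ℝ)) j).trans h3).trans (Nat.le_ceil _)
    rw [Finset.mem_Icc, ← abs_le]
    exact_mod_cast h4

/-- The semiclassical Fourier transform of the weighted sampling comb `c ∑ₖ f(pₖ) δ_{pₖ}`. -/
noncomputable def sampledFT {n : ℕ} {ι : Type*} (T : Finset ι) (p : ι → Fin n → ℝ) (h c : ℝ)
    (f : (Fin n → ℝ) → ℂ) (ξ : Fin n → ℝ) : ℂ :=
  (c : ℂ) * ∑ k ∈ T, exp (((-(dotp (p k) ξ) / h : ℝ) : ℂ) * I) * f (p k)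

section SampledFT

variable {n : ℕ} {ι : Type*} (T : Finset ι) (p : ι → Fin n → ℝ) (h c : ℝ)
  (f : (Fin n → ℝ) → ℂ)

theorem contDiff_sampledFT : ContDiff ℝ (⊤ : ℕ∞) (sampledFT T p h c f) := by
  refine contDiff_const.mul (ContDiff.sum fun k _ => ContDiff.mul (ContDiff.cexp
    (ContDiff.mul (ofRealCLM.contDiff.comp ?_) contDiff_const)) contDiff_const)
  unfold dotp
  exact ContDiff.div_const (by fun_prop) h

theorem norm_sampledFT_le {B : ℝ} (hB : ∀ x, ‖f x‖ ≤ B) (ξ : Fin n → ℝ) :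
    ‖sampledFT T p h c f ξ‖ ≤ |c| * (T.card * B) := by
  rw [sampledFT, norm_mul, norm_real, Real.norm_eq_abs]
  gcongr
  refine (norm_sum_le _ _).trans ?_
  rw [← nsmul_eq_mul]
  refine Finset.sum_le_card_nsmul _ _ _ fun k _ => ?_
  rw [norm_exp_ofReal_mul_I_mul]
  exact hB _

theorem scInvFT_mul_sampledFT {χ : (Fin n → ℝ) → ℂ} (hχ : Integrable χ)
    (x : Fin n → ℝ) :
    scInvFT h (fun ξ => χ ξ * sampledFT T p h c f ξ) x =
      ((c * (h ^ n)⁻¹ : ℝ) : ℂ) * ∑ k ∈ T, f (p k) * invFTn χ (h⁻¹ • (x - p k)) := by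
  have h1 : ∀ ξ, exp (((dotp x ξ / h : ℝ) : ℂ) * I) * (χ ξ * sampledFT T p h c f ξ) =
      (c : ℂ) * ∑ k ∈ T, f (p k) * (exp ((dotp (h⁻¹ • (x - p k)) ξ : ℂ) * I) * χ ξ) := by
    intro ξ
    rw [sampledFT, Finset.mul_sum, Finset.mul_sum, Finset.mul_sum, Finset.mul_sum]
    refine Finset.sum_congr rfl fun k _ => ?_
    have : exp ((dotp (h⁻¹ • (x - p k)) ξ : ℂ) * I) = exp (((dotp x ξ / h : ℝ) : ℂ) * I) *
        exp (((-(dotp (p k) ξ) / h : ℝ) : ℂ) * I) := by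
      rw [← Complex.exp_add, dotp_smul_left, dotp_sub_left]
      congr 1
      push_cast
      ring
    rw [this]
    ring
  rw [scInvFT]
  simp only [h1]
  rw [integral_const_mul, integral_finsetSum _ fun k _ =>
    (integrable_exp_mul hχ (by fun_prop)).const_mul _]
  simp only [integral_const_mul, invFTn, real_smul, mul_pow, mul_inv, Finset.mul_sum]
  refine Finset.sum_congr rfl fun k _ => ?_
  push_cast
  ring

variable {h f} in
theorem integral_scFT_mul_conj_sampledFT (hh : 0 < h) (hf : ContDiff ℝ (⊤ : ℕ∞) f)
    (hfc : HasCompactSupport f) (hF : Integrable (scFT h f)) :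
    ((((2 * Real.pi * h) ^ n)⁻¹ : ℝ) : ℂ) *
      ∫ ξ, scFT h f ξ * (starRingEnd ℂ) (sampledFT T p h c f ξ) =
      ((c * ∑ k ∈ T, ‖f (p k)‖ ^ 2 : ℝ) : ℂ) := by
  have h1 : ∀ ξ, scFT h f ξ * (starRingEnd ℂ) (sampledFT T p h c f ξ) =
      (c : ℂ) * ∑ k ∈ T, (starRingEnd ℂ) (f (p k)) *
        (exp (((dotp (p k) ξ / h : ℝ) : ℂ) * I) * scFT h f ξ) := by
    intro ξ
    rw [sampledFT, map_mul, map_sum, conj_ofReal, Finset.mul_sum, Finset.mul_sum, Finset.mul_sum]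
    refine Finset.sum_congr rfl fun k _ => ?_
    rw [map_mul, ← exp_conj, map_mul, conj_ofReal, conj_I]
    have : ((-(dotp (p k) ξ) / h : ℝ) : ℂ) * -I = ((dotp (p k) ξ / h : ℝ) : ℂ) * I := by
      push_cast; ring
    rw [this]
    ring
  simp only [h1]
  rw [integral_const_mul, integral_finsetSum _ fun k _ =>
    (integrable_exp_mul hF (by fun_prop)).const_mul _]
  simp only [integral_const_mul]
  push_cast
  rw [mul_left_comm, Finset.mul_sum]
  congr 1
  refine Finset.sum_congr rfl fun k _ => ?_
  have h2 := scInvFT_scFT hh hf hfc (p k)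
  rw [scInvFT, real_smul] at h2
  rw [mul_left_comm]
  push_cast at h2
  rw [h2, mul_comm, mul_conj, normSq_eq_norm_sq]
  push_cast
  rfl

end SampledFT

/-- If the translates `𝓑 + bₘ` are disjoint and `Gξ = ∑ₘ F(ξ + bₘ)`, then on `𝓑` the aliasing
error `G - F` is controlled by the mass of `F` outside `𝓑`. -/
theorem setIntegral_norm_aliasing_le {n : ℕ} {ι : Type*} [Countable ι] {𝓑 : Set (Fin n → ℝ)}
    (h𝓑 : IsOpen 𝓑) {b : ι → Fin n → ℝ} {i₀ : ι} (hb0 : b i₀ = 0)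
    (hdisj : ∀ k k', k ≠ k' → Disjoint ((fun ξ => ξ + b k) '' 𝓑) ((fun ξ => ξ + b k') '' 𝓑))
    {F G u : (Fin n → ℝ) → ℂ} (hF : Continuous F) (hG : Continuous G) (hu : Integrable u)
    (huF : ∀ ξ ∉ 𝓑, u ξ = F ξ) (hsum : ∀ ξ, HasSum (fun m => F (ξ + b m)) (G ξ)) :
    ∫ ξ in 𝓑, ‖G ξ - F ξ‖ ≤ ∫ ξ, ‖u ξ‖ := by
  classical
  have hpt : ∀ ξ ∈ 𝓑, ‖G ξ - F ξ‖ₑ ≤ ∑' m, ‖u (ξ + b m)‖ₑ := by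
    intro ξ hξ
    have h1 := (hsum ξ).update i₀ 0
    rw [hb0, add_zero, zero_sub, neg_add_eq_sub] at h1
    rw [← h1.tsum_eq]
    refine enorm_tsum_le_tsum_enorm.trans (ENNReal.tsum_le_tsum fun m => ?_)
    rcases eq_or_ne m i₀ with rfl | hm
    · simp
    · rw [Function.update_of_ne hm, huF]
      intro hmem
      exact Set.disjoint_left.1 (hdisj m i₀ hm) ⟨ξ, hξ, rfl⟩ ⟨_, hmem, by simp [hb0]⟩
  have hl : ∫⁻ ξ in 𝓑, ‖G ξ - F ξ‖ₑ ≤ ∫⁻ ξ, ‖u ξ‖ₑ := by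
    calc ∫⁻ ξ in 𝓑, ‖G ξ - F ξ‖ₑ ≤ ∫⁻ ξ in 𝓑, ∑' m, ‖u (ξ + b m)‖ₑ :=
          setLIntegral_mono' h𝓑.measurableSet hpt
      _ = ∑' m, ∫⁻ ξ in 𝓑, ‖u (ξ + b m)‖ₑ := lintegral_tsum fun m =>
          ((hu.comp_add_right (b m)).aestronglyMeasurable.enorm).restrict
      _ = ∑' m, ∫⁻ ξ in (fun ξ => ξ + b m) '' 𝓑, ‖u ξ‖ₑ := by
          refine tsum_congr fun m => ?_
          exact (measurePreserving_add_right volume (b m)).setLIntegral_comp_emb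
            (measurableEmbedding_addRight (b m)) (fun ξ => ‖u ξ‖ₑ) 𝓑
      _ = ∫⁻ ξ in ⋃ m, (fun ξ => ξ + b m) '' 𝓑, ‖u ξ‖ₑ :=
          (lintegral_iUnion (fun m => (measurableEmbedding_addRight (b m)).measurableSet_image'
            h𝓑.measurableSet) (fun k k' hk => hdisj k k' hk) _).symm
      _ ≤ _ := setLIntegral_le_lintegral _ _
  rw [integral_norm_eq_lintegral_enorm (f := fun ξ => G ξ - F ξ) (hG.sub hF).aestronglyMeasurable,
    integral_norm_eq_lintegral_enorm hu.aestronglyMeasurable]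
  exact ENNReal.toReal_mono hu.2.ne hl

theorem integral_norm_mul_aliasing_le {n : ℕ} {ι : Type*} [Countable ι] {𝓑 : Set (Fin n → ℝ)}
    {b : ι → Fin n → ℝ} {i₀ : ι} {B : ℝ} {χ : (Fin n → ℝ) → ℂ} (h𝓑 : IsOpen 𝓑) (h𝓑b : Bornology.IsBounded 𝓑)
    (hb0 : b i₀ = 0)
    (hdisj : ∀ k k', k ≠ k' → Disjoint ((fun ξ => ξ + b k) '' 𝓑) ((fun ξ => ξ + b k') '' 𝓑))
    {F G : (Fin n → ℝ) → ℂ} (hF : Continuous F) (hG : Continuous G)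
    (hu : Integrable fun ξ => (1 - χ ξ) * F ξ) (hχ𝓑 : ∀ ξ ∉ 𝓑, χ ξ = 0) (hχB : ∀ ξ, ‖χ ξ‖ ≤ B)
    (hsum : ∀ ξ, HasSum (fun m => F (ξ + b m)) (G ξ)) :
    ∫ ξ, ‖χ ξ * (G ξ - F ξ)‖ ≤ B * ∫ ξ, ‖(1 - χ ξ) * F ξ‖ := by
  have hB0 : 0 ≤ B := (norm_nonneg _).trans (hχB 0)
  have h1 : ∫ ξ, ‖χ ξ * (G ξ - F ξ)‖ = ∫ ξ in 𝓑, ‖χ ξ * (G ξ - F ξ)‖ :=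
    (setIntegral_eq_integral_of_forall_compl_eq_zero fun ξ hξ => by simp [hχ𝓑 ξ hξ]).symm
  obtain ⟨R, hR⟩ := h𝓑b.subset_closedBall 0
  have hi : IntegrableOn (fun ξ => ‖G ξ - F ξ‖) 𝓑 :=
    ((hG.sub hF).norm.continuousOn.integrableOn_compact (isCompact_closedBall 0 R)).mono_set hR
  rw [h1]
  calc ∫ ξ in 𝓑, ‖χ ξ * (G ξ - F ξ)‖ ≤ ∫ ξ in 𝓑, B * ‖G ξ - F ξ‖ := by
        refine integral_mono_of_nonneg (Filter.Eventually.of_forall fun ξ => norm_nonneg _)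
          (hi.const_mul B) (Filter.Eventually.of_forall fun ξ => ?_)
        simp only [norm_mul]
        gcongr
        exact hχB ξ
    _ = B * ∫ ξ in 𝓑, ‖G ξ - F ξ‖ := integral_const_mul _ _
    _ ≤ _ := by
        gcongr
        exact setIntegral_norm_aliasing_le h𝓑 hb0 hdisj hF hG hu
          (fun ξ hξ => by simp [hχ𝓑 ξ hξ]) hsum


section Sampling

variable {n : ℕ} {ι : Type*} {h c B D : ℝ} {f χ : (Fin n → ℝ) → ℂ} {T : Finset ι}
  {p : ι → Fin n → ℝ}

theorem norm_le_of_integrable_one_sub_mul_scFT (hh : 0 < h) (hf : ContDiff ℝ (⊤ : ℕ∞) f)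
    (hfc : HasCompactSupport f) (hχ : Integrable χ)
    (hu : Integrable fun ξ => (1 - χ ξ) * scFT h f ξ) (x : Fin n → ℝ) :
    ‖f x‖ ≤ ((2 * Real.pi * h) ^ n)⁻¹ *
      ((∫ ξ, ‖χ ξ‖) * (∫ x, ‖f x‖) + ∫ ξ, ‖(1 - χ ξ) * scFT h f ξ‖) := by
  rw [← scInvFT_scFT hh hf hfc x, scInvFT, norm_smul, Real.norm_of_nonneg (by positivity)]
  gcongr
  refine (norm_integral_le_integral_norm _).trans ?_
  simp only [norm_exp_ofReal_mul_I_mul]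
  rw [← integral_mul_const, ← integral_add (hχ.norm.mul_const _) hu.norm]
  refine integral_mono_of_nonneg (Filter.Eventually.of_forall fun ξ => norm_nonneg _)
    ((hχ.norm.mul_const _).add hu.norm) (Filter.Eventually.of_forall fun ξ => ?_)
  simp only
  calc ‖scFT h f ξ‖ = ‖χ ξ * scFT h f ξ + (1 - χ ξ) * scFT h f ξ‖ := by congr 1; ring
    _ ≤ ‖χ ξ‖ * ‖scFT h f ξ‖ + ‖(1 - χ ξ) * scFT h f ξ‖ := by
        rw [← norm_mul]; exact norm_add_le _ _
    _ ≤ _ := by gcongr; exact norm_scFT_le h f ξ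

theorem integral_norm_sq_sub_scInvFT_mul_sampledFT_le (hh : 0 < h) (hf : ContDiff ℝ (⊤ : ℕ∞) f)
    (hfc : HasCompactSupport f) (hχ : ContDiff ℝ (⊤ : ℕ∞) χ) (hχc : HasCompactSupport χ)
    (hχB : ∀ ξ, ‖χ ξ‖ ≤ B) (hu : Integrable fun ξ => (1 - χ ξ) * scFT h f ξ)
    (hD : ∀ ξ, ‖sampledFT T p h c f ξ - scFT h f ξ‖ ≤ D)
    (hal : ∫ ξ, ‖χ ξ * (sampledFT T p h c f ξ - scFT h f ξ)‖ ≤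
      B * ∫ ξ, ‖(1 - χ ξ) * scFT h f ξ‖) :
    ∫ x, ‖f x - scInvFT h (fun ξ => χ ξ * sampledFT T p h c f ξ) x‖ ^ 2 ≤
      ((2 * Real.pi * h) ^ n)⁻¹ * (((1 + B) * (∫ x, ‖f x‖) + B * D) *
        ((1 + B) * ∫ ξ, ‖(1 - χ ξ) * scFT h f ξ‖)) := by
  have hB0 : 0 ≤ B := (norm_nonneg _).trans (hχB 0)
  have hD0 : 0 ≤ D := (norm_nonneg _).trans (hD 0)
  set u := fun ξ => (1 - χ ξ) * scFT h f ξ with hu'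
  set v := fun ξ => χ ξ * (sampledFT T p h c f ξ - scFT h f ξ) with hv'
  have hGs := contDiff_sampledFT T p h c f
  have hFc := continuous_scFT h (hf.continuous.integrable_of_hasCompactSupport hfc)
  have hv : Integrable v := (hχ.continuous.mul (hGs.continuous.sub hFc)).integrable_of_hasCompactSupport
    hχc.mul_right
  have hL := norm_scFT_le h f
  rw [integral_norm_sq_sub_scInvFT hh hf hfc (hχ.mul hGs) hχc.mul_right]
  gcongr
  have hle : ∀ ξ, ‖scFT h f ξ - χ ξ * sampledFT T p h c f ξ‖ ≤ ‖u ξ‖ + ‖v ξ‖ := fun ξ => by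
    refine le_trans (le_of_eq ?_) (norm_sub_le (u ξ) (v ξ))
    simp only [hu', hv']
    congr 1
    ring
  have hsup : ∀ ξ, ‖u ξ‖ + ‖v ξ‖ ≤ (1 + B) * (∫ x, ‖f x‖) + B * D := fun ξ => by
    simp only [hu', hv', norm_mul]
    gcongr
    · exact (norm_sub_le _ _).trans (by simpa using hχB ξ)
    · exact hL ξ
    · exact hχB ξ
    · exact hD ξ
  calc ∫ ξ, ‖scFT h f ξ - χ ξ * sampledFT T p h c f ξ‖ ^ 2
      ≤ ∫ ξ, ((1 + B) * (∫ x, ‖f x‖) + B * D) * (‖u ξ‖ + ‖v ξ‖) := by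
        refine integral_mono_of_nonneg (Filter.Eventually.of_forall fun ξ => by positivity)
          ((hu.norm.add hv.norm).const_mul _) (Filter.Eventually.of_forall fun ξ => ?_)
        simp only [sq]
        exact mul_le_mul ((hle ξ).trans (hsup ξ)) (hle ξ) (norm_nonneg _)
          (((norm_nonneg _).trans (hle ξ)).trans (hsup ξ))
    _ = ((1 + B) * (∫ x, ‖f x‖) + B * D) * ((∫ ξ, ‖u ξ‖) + ∫ ξ, ‖v ξ‖) := by
        rw [integral_const_mul, integral_add hu.norm hv.norm]
    _ ≤ _ := by
        have : 0 ≤ ∫ x, ‖f x‖ := integral_nonneg fun _ => norm_nonneg _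
        gcongr
        linarith

theorem abs_integral_norm_sq_sub_sampled_le (hh : 0 < h) (hf : ContDiff ℝ (⊤ : ℕ∞) f)
    (hfc : HasCompactSupport f) (hχ : ContDiff ℝ (⊤ : ℕ∞) χ) (hχc : HasCompactSupport χ)
    (hu : Integrable fun ξ => (1 - χ ξ) * scFT h f ξ)
    (hD : ∀ ξ, ‖sampledFT T p h c f ξ - scFT h f ξ‖ ≤ D)
    (hal : ∫ ξ, ‖χ ξ * (sampledFT T p h c f ξ - scFT h f ξ)‖ ≤
      B * ∫ ξ, ‖(1 - χ ξ) * scFT h f ξ‖) :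
    |(∫ x, ‖f x‖ ^ 2) - c * ∑ k ∈ T, ‖f (p k)‖ ^ 2| ≤
      ((2 * Real.pi * h) ^ n)⁻¹ * ((B * (∫ x, ‖f x‖) + D) *
        ∫ ξ, ‖(1 - χ ξ) * scFT h f ξ‖) := by
  set u := fun ξ => (1 - χ ξ) * scFT h f ξ with hu'
  set Q := fun ξ => sampledFT T p h c f ξ - scFT h f ξ with hQ
  have hGs := contDiff_sampledFT T p h c f
  have hFc := continuous_scFT h (hf.continuous.integrable_of_hasCompactSupport hfc)
  have hQc : Continuous Q := hGs.continuous.sub hFc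
  have hv : Integrable fun ξ => χ ξ * Q ξ :=
    (hχ.continuous.mul hQc).integrable_of_hasCompactSupport hχc.mul_right
  have hFi : Integrable (scFT h f) := by
    have h1 : Integrable fun ξ => χ ξ * scFT h f ξ :=
      (hχ.continuous.mul hFc).integrable_of_hasCompactSupport hχc.mul_right
    refine (h1.add hu).congr (Filter.Eventually.of_forall fun ξ => ?_)
    simp only [hu', Pi.add_apply]
    ring
  have hbdd : ∀ {g : (Fin n → ℝ) → ℂ} {E : ℝ}, Continuous g → (∀ ξ, ‖g ξ‖ ≤ E) →
      Integrable fun ξ => scFT h f ξ * (starRingEnd ℂ) (g ξ) := fun hg hE =>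
    hFi.mul_bdd (continuous_conj.comp hg).aestronglyMeasurable
      (Filter.Eventually.of_forall fun ξ => by simpa using hE ξ)
  have hFF := hbdd hFc (norm_scFT_le h f)
  have hFQ := hbdd hQc hD
  have hpl : ((∫ x, ‖f x‖ ^ 2 : ℝ) : ℂ) = ((((2 * Real.pi * h) ^ n)⁻¹ : ℝ) : ℂ) *
      ∫ ξ, scFT h f ξ * (starRingEnd ℂ) (scFT h f ξ) := by
    have h1 := integral_norm_sq_sub_scInvFT hh hf hfc (g := fun _ => 0) contDiff_const
      HasCompactSupport.zero
    simp only [scInvFT, mul_zero, integral_zero, smul_zero, sub_zero] at h1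
    rw [h1, ofReal_mul, ← integral_complex_ofReal]
    congr 2
    ext ξ
    rw [mul_conj, normSq_eq_norm_sq]
  have hG := integral_scFT_mul_conj_sampledFT T p c hh hf hfc hFi
  have hdiff : (((∫ x, ‖f x‖ ^ 2) - c * ∑ k ∈ T, ‖f (p k)‖ ^ 2 : ℝ) : ℂ) =
      -(((((2 * Real.pi * h) ^ n)⁻¹ : ℝ) : ℂ) * ∫ ξ, scFT h f ξ * (starRingEnd ℂ) (Q ξ)) := by
    have hFG : ∫ ξ, scFT h f ξ * (starRingEnd ℂ) (sampledFT T p h c f ξ) =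
        (∫ ξ, scFT h f ξ * (starRingEnd ℂ) (scFT h f ξ)) +
          ∫ ξ, scFT h f ξ * (starRingEnd ℂ) (Q ξ) := by
      rw [← integral_add hFF hFQ]
      congr 1
      ext ξ
      simp only [hQ, map_sub]
      ring
    rw [ofReal_sub, hpl, ← hG, hFG]
    ring
  rw [← Real.norm_eq_abs, ← norm_real, hdiff, norm_neg, norm_mul, norm_real,
    Real.norm_of_nonneg (by positivity)]
  gcongr
  calc ‖∫ ξ, scFT h f ξ * (starRingEnd ℂ) (Q ξ)‖
      ≤ ∫ ξ, ((∫ x, ‖f x‖) * ‖χ ξ * Q ξ‖ + D * ‖u ξ‖) := by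
        refine norm_integral_le_of_norm_le ((hv.norm.const_mul _).add (hu.norm.const_mul _))
          (Filter.Eventually.of_forall fun ξ => ?_)
        rw [norm_mul, norm_conj]
        calc ‖scFT h f ξ‖ * ‖Q ξ‖ = ‖scFT h f ξ * (χ ξ * Q ξ) + Q ξ * u ξ‖ := by
              rw [← norm_mul]; congr 1; simp only [hu']; ring
          _ ≤ ‖scFT h f ξ‖ * ‖χ ξ * Q ξ‖ + ‖Q ξ‖ * ‖u ξ‖ := by
              refine (norm_add_le _ _).trans_eq ?_
              rw [norm_mul (scFT h f ξ), norm_mul (Q ξ)]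
          _ ≤ _ := by
              gcongr
              · exact norm_scFT_le h f ξ
              · exact hD ξ
    _ = (∫ x, ‖f x‖) * (∫ ξ, ‖χ ξ * Q ξ‖) + D * ∫ ξ, ‖u ξ‖ := by
        rw [integral_add (hv.norm.const_mul _) (hu.norm.const_mul _), integral_const_mul,
          integral_const_mul]
    _ ≤ (∫ x, ‖f x‖) * (B * ∫ ξ, ‖u ξ‖) + D * ∫ ξ, ‖u ξ‖ := by
        have : 0 ≤ ∫ x, ‖f x‖ := integral_nonneg fun _ => norm_nonneg _
        gcongr
    _ = _ := by ring

end Sampling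

/-- the semiclassical sampling theorem on the general periodic lattice
`shWℤⁿ`. Under the phase-space localization hypothesis
`‖(Id−ψ(x,hD))f_h‖_{H_h^m} = O_m(h^∞)‖f_h‖` and the disjointness of the translates
`𝓑 + (2π/s)(Wᵀ)⁻¹k`, one has
`f_h(x) = |det W| sⁿ Σ_k f_h(shWk) χ((x−shWk)/h) + O_{L²}(h^∞)‖f_h‖` and
`‖f_h‖² = |det W|(sh)ⁿ Σ_k |f_h(shWk)|² + O(h^∞)‖f_h‖²`. -/
theorem stmt3 (n : ℕ)
    (Ω : Set (Fin n → ℝ)) (hΩo : IsOpen Ω) (hΩb : Bornology.IsBounded Ω)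
    (𝓑₀ 𝓑 : Set (Fin n → ℝ)) (h𝓑₀o : IsOpen 𝓑₀) (h𝓑o : IsOpen 𝓑)
    (h𝓑₀b : Bornology.IsBounded 𝓑₀) (h𝓑b : Bornology.IsBounded 𝓑)
    (hcl : closure 𝓑₀ ⊆ 𝓑)
    (ψ : (Fin n → ℝ) → (Fin n → ℝ) → ℂ)
    (hψsm : ContDiff ℝ (⊤ : ℕ∞) (fun q : (Fin n → ℝ) × (Fin n → ℝ) => ψ q.1 q.2))
    (hψcs : HasCompactSupport (fun q : (Fin n → ℝ) × (Fin n → ℝ) => ψ q.1 q.2))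
    (hψ1 : ∀ x : Fin n → ℝ, ∀ ξ ∈ 𝓑₀, ψ x ξ = 1)
    (hψ0 : ∀ x : Fin n → ℝ, ∀ ξ : Fin n → ℝ, ξ ∉ 𝓑 → ψ x ξ = 0)
    (f : ℝ → (Fin n → ℝ) → ℂ)
    (hfsm : ∀ h ∈ Set.Ioc (0 : ℝ) 1, ContDiff ℝ (⊤ : ℕ∞) (f h) ∧ HasCompactSupport (f h))
    (hfsupp : ∀ h ∈ Set.Ioc (0 : ℝ) 1, tsupport (f h) ⊆ Ω)
    (hloc : ∀ m : ℝ, 0 ≤ m → ∀ N : ℕ, ∃ C : ℝ, ∀ h ∈ Set.Ioc (0 : ℝ) 1,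
      Real.sqrt (hSobSq n h m (fun x => f h x - scOp h ψ (f h) x)) ≤
        C * h ^ N * Real.sqrt (∫ x : Fin n → ℝ, ‖f h x‖ ^ 2))
    (χhat : (Fin n → ℝ) → ℂ) (hχsm : ContDiff ℝ (⊤ : ℕ∞) χhat) (hχcs : HasCompactSupport χhat)
    (hχsupp : Function.support χhat ⊆ 𝓑)
    (hχψ : ∀ x ξ : Fin n → ℝ, χhat ξ * ψ x ξ = ψ x ξ)
    (W : Matrix (Fin n) (Fin n) ℝ) (hW : IsUnit W.det)
    (s : ℝ) (hs0 : 0 < s) (hs1 : s < 1)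
    (hdisj : ∀ k k' : Fin n → ℤ, k ≠ k' →
      Disjoint
        ((fun ξ : Fin n → ℝ =>
          ξ + (2 * Real.pi / s) • (W.transpose)⁻¹.mulVec (fun j => (k j : ℝ))) '' 𝓑)
        ((fun ξ : Fin n → ℝ =>
          ξ + (2 * Real.pi / s) • (W.transpose)⁻¹.mulVec (fun j => (k' j : ℝ))) '' 𝓑)) :
    (∀ N : ℕ, ∃ C : ℝ, ∀ h ∈ Set.Ioc (0 : ℝ) 1,
      Real.sqrt (∫ x : Fin n → ℝ,
          ‖f h x - |W.det| • s ^ n •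
              ∑' k : Fin n → ℤ,
                f h ((s * h) • W.mulVec (fun j => (k j : ℝ))) *
                  invFTn χhat (h⁻¹ • (x - (s * h) • W.mulVec (fun j => (k j : ℝ))))‖ ^ 2)
        ≤ C * h ^ N * Real.sqrt (∫ x : Fin n → ℝ, ‖f h x‖ ^ 2)) ∧
    (∀ N : ℕ, ∃ C : ℝ, ∀ h ∈ Set.Ioc (0 : ℝ) 1,
      |(∫ x : Fin n → ℝ, ‖f h x‖ ^ 2) -
          |W.det| * (s * h) ^ n *
            ∑' k : Fin n → ℤ, ‖f h ((s * h) • W.mulVec (fun j => (k j : ℝ)))‖ ^ 2|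
        ≤ C * h ^ N * ∫ x : Fin n → ℝ, ‖f h x‖ ^ 2) := by
  have hfΩ : ∀ h ∈ Set.Ioc (0 : ℝ) 1, ∀ x ∉ Ω, f h x = 0 := fun h hh x hx =>
    image_eq_zero_of_notMem_tsupport fun hx' => hx (hfsupp h hh hx')
  have hkey := exists_integral_one_sub_mul_scFT_le hΩo hΩb hψsm hψcs hfsm hfΩ hloc hχsm hχcs hχψ
  have hχ𝓑 : ∀ ξ ∉ 𝓑, χhat ξ = 0 := fun ξ hξ => by
    by_contra hne
    exact hξ (hχsupp hne)
  have hχi : Integrable χhat := hχsm.continuous.integrable_of_hasCompactSupport hχcs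
  obtain ⟨B, hB⟩ := hχcs.exists_bound_of_continuous hχsm.continuous
  have hB0 : 0 ≤ B := (norm_nonneg _).trans (hB 0)
  obtain ⟨CT, hCT0, hCT⟩ := exists_card_le_and_forall_notMem hΩb hW hs0
  obtain ⟨C₀, hC₀0, hC₀⟩ := hkey 0
  set l := √(volume.real Ω)
  set X := ∫ ξ, ‖χhat ξ‖
  have hX0 : 0 ≤ X := integral_nonneg fun _ => norm_nonneg _
  set p : (Fin n → ℤ) → ℝ → Fin n → ℝ := fun k h => (s * h) • W.mulVec (fun j => (k j : ℝ)) with hp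
  set d := |W.det| * CT * (X * l + C₀) + l with hd
  have hd0 : 0 ≤ d := by positivity
  have hscale : ∀ h ∈ Set.Ioc (0 : ℝ) 1, ((2 * Real.pi * h) ^ n)⁻¹ ≤ (h ^ n)⁻¹ := fun h hh => by
    have := hh.1
    gcongr
    nlinarith [Real.pi_gt_three]
  have hmain : ∀ h ∈ Set.Ioc (0 : ℝ) 1, ∃ T : Finset (Fin n → ℤ), (∀ k ∉ T, f h (p k h) = 0) ∧
      (∀ ξ, ‖sampledFT T (fun k => p k h) h (|W.det| * (s * h) ^ n) (f h) ξ - scFT h (f h) ξ‖ ≤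
        d * (h ^ n)⁻¹ * √(∫ x, ‖f h x‖ ^ 2)) ∧
      (∫ ξ, ‖χhat ξ * (sampledFT T (fun k => p k h) h (|W.det| * (s * h) ^ n) (f h) ξ -
        scFT h (f h) ξ)‖) ≤ B * ∫ ξ, ‖(1 - χhat ξ) * scFT h (f h) ξ‖ := by
    intro h hh
    have hh0 : 0 < h := hh.1
    obtain ⟨hfs, hfc⟩ := hfsm h hh
    obtain ⟨T, hTc, hT⟩ := hCT h hh
    obtain ⟨hui, hu⟩ := hC₀ h hh
    rw [pow_zero, mul_one] at hu
    have hTf : ∀ k ∉ T, f h (p k h) = 0 := fun k hk => hfΩ h hh _ (hT k hk)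
    have hL := integral_norm_le_sqrt_mul_sqrt hΩo.measurableSet hΩb hfs.continuous hfc (hfΩ h hh)
    set M := √(∫ x, ‖f h x‖ ^ 2)
    have hM0 : 0 ≤ M := Real.sqrt_nonneg _
    have hn1 : 1 ≤ (h ^ n)⁻¹ := (one_le_inv₀ (by positivity)).2 (pow_le_one₀ hh0.le hh.2)
    refine ⟨T, hTf, fun ξ => ?_, ?_⟩
    · have hfb : ∀ x, ‖f h x‖ ≤ (h ^ n)⁻¹ * ((X * l + C₀) * M) := fun x => by
        refine (norm_le_of_integrable_one_sub_mul_scFT hh0 hfs hfc hχi hui x).trans ?_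
        gcongr ?_ * ?_
        · exact hscale h hh
        · calc _ ≤ X * (l * M) + C₀ * M := by gcongr
            _ = _ := by ring
      calc _ ≤ ‖sampledFT T (fun k => p k h) h (|W.det| * (s * h) ^ n) (f h) ξ‖ +
            ‖scFT h (f h) ξ‖ := norm_sub_le _ _
        _ ≤ |W.det| * (1 * h) ^ n * (CT * (h ^ n)⁻¹ * ((h ^ n)⁻¹ * ((X * l + C₀) * M))) +
            l * M * (h ^ n)⁻¹ := by
          refine add_le_add ((norm_sampledFT_le T _ h _ _ hfb ξ).trans ?_)
            (((norm_scFT_le h (f h) ξ).trans hL).trans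
              (le_mul_of_one_le_right (by positivity) hn1))
          rw [abs_of_nonneg (by positivity)]
          gcongr
        _ = d * (h ^ n)⁻¹ * M := by
          rw [hd, one_mul]
          field_simp
    · refine integral_norm_mul_aliasing_le h𝓑o h𝓑b (i₀ := (0 : Fin n → ℤ)) ?_ hdisj
        (continuous_scFT h (hfs.continuous.integrable_of_hasCompactSupport hfc))
        (contDiff_sampledFT _ _ _ _ _).continuous hui hχ𝓑 hB fun ξ => ?_
      · have : (fun j => (((0 : Fin n → ℤ) j : ℤ) : ℝ)) = 0 := by ext; simp
        rw [this, Matrix.mulVec_zero, smul_zero]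
      · have := hasSum_scFT_dual_lattice hfs hfc hW hs0 hh0 ξ
        rwa [tsum_eq_sum (s := T) fun k hk => by rw [hTf k hk, mul_zero]] at this
  refine ⟨fun N => ?_, fun N => ?_⟩
  · obtain ⟨C, hC0, hC⟩ := hkey (2 * N + 2 * n)
    refine ⟨√(((1 + B) * l + B * d) * ((1 + B) * C)), fun h hh => ?_⟩
    have hh0 : 0 < h := hh.1
    obtain ⟨hfs, hfc⟩ := hfsm h hh
    obtain ⟨T, hTf, hD, hal⟩ := hmain h hh
    obtain ⟨hui, hu⟩ := hC h hh
    have hL := integral_norm_le_sqrt_mul_sqrt hΩo.measurableSet hΩb hfs.continuous hfc (hfΩ h hh)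
    have hn1 : 1 ≤ (h ^ n)⁻¹ := (one_le_inv₀ (by positivity)).2 (pow_le_one₀ hh0.le hh.2)
    have hest := integral_norm_sq_sub_scInvFT_mul_sampledFT_le hh0 hfs hfc hχsm hχcs hB hui hD hal
    set M := √(∫ x, ‖f h x‖ ^ 2)
    have hM0 : 0 ≤ M := Real.sqrt_nonneg _
    have hrw : ∀ x, |W.det| • s ^ n • ∑' k : Fin n → ℤ,
          f h (p k h) * invFTn χhat (h⁻¹ • (x - p k h)) =
        scInvFT h (fun ξ => χhat ξ *
          sampledFT T (fun k => p k h) h (|W.det| * (s * h) ^ n) (f h) ξ) x := fun x => by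
      rw [scInvFT_mul_sampledFT _ _ _ _ _ hχi,
        tsum_eq_sum (s := T) fun k hk => by rw [hTf k hk, zero_mul], smul_smul, real_smul]
      congr 2
      rw [mul_pow]
      field_simp
    have hfin : ∫ x, ‖f h x - |W.det| • s ^ n • ∑' k : Fin n → ℤ,
          f h (p k h) * invFTn χhat (h⁻¹ • (x - p k h))‖ ^ 2 ≤
        ((1 + B) * l + B * d) * ((1 + B) * C) * (h ^ N * M) ^ 2 := by
      simp only [hrw]
      refine hest.trans ?_
      calc _ ≤ (h ^ n)⁻¹ * (((1 + B) * (l * M * (h ^ n)⁻¹) + B * (d * (h ^ n)⁻¹ * M)) *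
            ((1 + B) * (C * h ^ (2 * N + 2 * n) * M))) := by
            gcongr ?_ * ((?_ * ?_ + ?_) * (?_ * ?_))
            · exact hscale h hh
            · exact hL.trans (le_mul_of_one_le_right (by positivity) hn1)
            · exact le_rfl
        _ = _ := by
            rw [pow_add, pow_mul, pow_mul]
            field_simp
            ring
    calc _ ≤ √(((1 + B) * l + B * d) * ((1 + B) * C) * (h ^ N * M) ^ 2) := Real.sqrt_le_sqrt hfin
      _ = _ := by
        rw [Real.sqrt_mul (by positivity), Real.sqrt_sq (by positivity), mul_assoc]
  · obtain ⟨C, hC0, hC⟩ := hkey (N + 2 * n)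
    refine ⟨(B * l + d) * C, fun h hh => ?_⟩
    have hh0 : 0 < h := hh.1
    obtain ⟨hfs, hfc⟩ := hfsm h hh
    obtain ⟨T, hTf, hD, hal⟩ := hmain h hh
    obtain ⟨hui, hu⟩ := hC h hh
    have hL := integral_norm_le_sqrt_mul_sqrt hΩo.measurableSet hΩb hfs.continuous hfc (hfΩ h hh)
    have hn1 : 1 ≤ (h ^ n)⁻¹ := (one_le_inv₀ (by positivity)).2 (pow_le_one₀ hh0.le hh.2)
    have hest := abs_integral_norm_sq_sub_sampled_le hh0 hfs hfc hχsm hχcs hui hD hal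
    have hMM : ∫ x, ‖f h x‖ ^ 2 = √(∫ x, ‖f h x‖ ^ 2) ^ 2 :=
      (Real.sq_sqrt (integral_nonneg fun x => by positivity)).symm
    rw [tsum_eq_sum (s := T) fun k hk => by
      have := hTf k hk
      simp only [hp] at this
      rw [this, norm_zero, zero_pow two_ne_zero]]
    refine hest.trans ?_
    rw [hMM, Real.sqrt_sq (Real.sqrt_nonneg _)]
    set M := √(∫ x, ‖f h x‖ ^ 2)
    have hM0 : 0 ≤ M := Real.sqrt_nonneg _
    calc _ ≤ (h ^ n)⁻¹ * ((B * (l * M * (h ^ n)⁻¹) + d * (h ^ n)⁻¹ * M) *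
          (C * h ^ (N + 2 * n) * M)) := by
          gcongr ?_ * ((?_ * ?_ + ?_) * ?_)
          · exact hscale h hh
          · exact hL.trans (le_mul_of_one_le_right (by positivity) hn1)
          · exact le_rfl
      _ = _ := by
          rw [pow_add, pow_mul]
          field_simp
          ring
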